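/- For all constants c_1, c_2 > 0 there exists a constant c > 0 such that the following holds. Let p be a prime, let Y ⊆ F_p \ {0} be nonempty with |Y| ≤ c_1 |C|^2 and |C|^2 |Y| ≤ c_2 p^2, let C ⊆ F_p be nonempty, and let E = C × C. Then there exists y ∈ Y such that #{a·y + b : (a, b) ∈ E} ≥ c · min( |Y|^{1/4} |C|^{5/2} / E^+(C)^{1/2}, |C|^2 ). -/

import Mathlib

/-- `addEnergy2 A B` is `E^+(A, B) = #{(a, b, a', b') ∈ A × B × A × B : a + b = a' + b'}`. -/
noncomputable def addEnergy2 {F : Type*} [Add F] (A B : Set F) : ℕ :=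
  {t : F × F × F × F | t.1 ∈ A ∧ t.2.1 ∈ B ∧ t.2.2.1 ∈ A ∧ t.2.2.2 ∈ B ∧
      t.1 + t.2.1 = t.2.2.1 + t.2.2.2}.ncard

/-- `addEnergy C` is the additive energy `E^+(C) = E^+(C, C)`. -/
noncomputable def addEnergy {F : Type*} [Add F] (C : Set F) : ℕ := addEnergy2 C C

/-- The affine line `{(x, z, w) : z = β + m x, w = γ + m² x}`, whose direction `(1, m, m²)` is
isotropic for `z² - x w`. -/
@[ext]
structure NullLine (K : Type*) where
  /-- The slope. -/
  m : K
  /-- The `z`-intercept. -/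
  β : K
  /-- The `w`-intercept. -/
  γ : K

namespace NullLine

open MvPolynomial

variable {K : Type*} [Field K]

/-- The point of `l` with `x = s`; the coordinates are ordered as `(w, x, z)`. -/
def pt (l : NullLine K) (s : K) : Fin 3 → K := ![l.γ + l.m ^ 2 * s, s, l.β + l.m * s]

/-- The null line of slope `m` through the point `y`. -/
def through (y : Fin 3 → K) (m : K) : NullLine K := ⟨m, y 2 - m * y 1, y 0 - m ^ 2 * y 1⟩

/-- Restriction of a polynomial to a null line, parametrized by `x`. -/
noncomputable def restr (l : NullLine K) : MvPolynomial (Fin 3) K →ₐ[K] Polynomial K :=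
  aeval ![Polynomial.C l.γ + Polynomial.C (l.m ^ 2) * Polynomial.X, Polynomial.X,
    Polynomial.C l.β + Polynomial.C l.m * Polynomial.X]

/-- The line `l` is contained in the zero set of `P`. -/
def On (l : NullLine K) (P : MvPolynomial (Fin 3) K) : Prop := restr l P = 0

/-- Differentiation in the direction of null lines of slope `m`. -/
noncomputable def dir (m : K) : Derivation K (MvPolynomial (Fin 3) K) (MvPolynomial (Fin 3) K) :=
  m ^ 2 • pderiv 0 + pderiv 1 + m • pderiv 2

/-- Two null lines of different slopes have a common point. -/
def Meets (l l' : NullLine K) : Prop :=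
  l.m ≠ l'.m ∧ l.γ - l'.γ = (l.m + l'.m) * (l.β - l'.β)

theorem pt_through (y : Fin 3 → K) (m : K) : (through y m).pt (y 1) = y := by
  funext i
  fin_cases i <;> simp [pt, through]

theorem through_pt (l : NullLine K) (s : K) : through (l.pt s) l.m = l := by
  ext <;> simp [pt, through]

theorem eval_restr (l : NullLine K) (P : MvPolynomial (Fin 3) K) (s : K) :
    (restr l P).eval s = eval (l.pt s) P := by
  have : ((Polynomial.aeval s).comp (restr l) : MvPolynomial (Fin 3) K →ₐ[K] K) =
      aeval (l.pt s) := by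
    apply MvPolynomial.algHom_ext
    intro i
    fin_cases i <;> simp [restr, pt]
  have h := DFunLike.congr_fun this P
  simpa [Polynomial.aeval_def, Polynomial.eval₂_eq_eval_map, aeval_eq_eval] using h

theorem natDegree_restr_le (l : NullLine K) (P : MvPolynomial (Fin 3) K) :
    (restr l P).natDegree ≤ P.totalDegree := by
  have := MvPolynomial.aeval_natDegree_le (n := 1) P le_rfl
    ![Polynomial.C l.γ + Polynomial.C (l.m ^ 2) * Polynomial.X, Polynomial.X,
    Polynomial.C l.β + Polynomial.C l.m * Polynomial.X] (by
      intro i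
      fin_cases i
      · show (Polynomial.C l.γ + Polynomial.C (l.m ^ 2) * Polynomial.X).natDegree ≤ 1
        compute_degree
      · simp
      · show (Polynomial.C l.β + Polynomial.C l.m * Polynomial.X).natDegree ≤ 1
        compute_degree)
  simpa [restr] using this

theorem dir_apply (m : K) (P : MvPolynomial (Fin 3) K) :
    dir m P = C (m ^ 2) * pderiv 0 P + pderiv 1 P + C m * pderiv 2 P := by
  simp [dir, MvPolynomial.smul_eq_C_mul]

theorem derivative_restr (l : NullLine K) (P : MvPolynomial (Fin 3) K) :
    Polynomial.derivative (restr l P) = restr l (dir l.m P) := by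
  induction P using MvPolynomial.induction_on with
  | C a => simp [restr]
  | add p q hp hq => simp [hp, hq]
  | mul_X p i hp =>
    rw [map_mul, Polynomial.derivative_mul, hp, Derivation.leibniz, map_add, smul_eq_mul,
      smul_eq_mul, map_mul, map_mul]
    have : Polynomial.derivative (restr l (X i)) = restr l (dir l.m (X i)) := by
      fin_cases i <;> simp [restr, dir_apply, pderiv_X, Polynomial.derivative_pow]
    rw [this]
    ring

theorem On.eval_eq_zero {l : NullLine K} {P : MvPolynomial (Fin 3) K} (h : l.On P) (s : K) :
    eval (l.pt s) P = 0 := by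
  rw [← eval_restr, h, Polynomial.eval_zero]

theorem On.of_dvd {l : NullLine K} {P Q : MvPolynomial (Fin 3) K} (h : l.On P) (hd : P ∣ Q) :
    l.On Q := by
  obtain ⟨R, rfl⟩ := hd
  simp [On, map_mul, show restr l P = 0 from h]

theorem On.dir {l : NullLine K} {P : MvPolynomial (Fin 3) K} (h : l.On P) :
    l.On (dir l.m P) := by
  rw [On, ← derivative_restr, show restr l P = 0 from h, Polynomial.derivative_zero]

theorem on_mul {l : NullLine K} {P Q : MvPolynomial (Fin 3) K} :
    l.On (P * Q) ↔ l.On P ∨ l.On Q := by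
  simp [On]

theorem on_of_infinite {l : NullLine K} {P : MvPolynomial (Fin 3) K}
    (h : {s | eval (l.pt s) P = 0}.Infinite) : l.On P := by
  apply Polynomial.eq_zero_of_infinite_isRoot
  simpa only [Polynomial.IsRoot, eval_restr] using h

/-- A null line not contained in `P = 0` meets it in at most `deg P` points. -/
theorem card_le_of_not_on {l : NullLine K} {P : MvPolynomial (Fin 3) K} (h : ¬ l.On P)
    (S : Finset K) (hS : ∀ s ∈ S, eval (l.pt s) P = 0) : S.card ≤ P.totalDegree := by
  refine le_trans ?_ (natDegree_restr_le l P)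
  apply Polynomial.card_le_degree_of_subset_roots (p := restr l P)
  intro s hs
  rw [Polynomial.mem_roots h, Polynomial.IsRoot, eval_restr]
  exact hS s hs

theorem Meets.symm {l l' : NullLine K} (h : l.Meets l') : l'.Meets l :=
  ⟨h.1.symm, by linear_combination -h.2⟩

theorem Meets.pt_eq {l l' : NullLine K} (h : l.Meets l') :
    ∃ s, l.pt s = l'.pt s := by
  have hm : l'.m - l.m ≠ 0 := sub_ne_zero.2 h.1.symm
  refine ⟨(l.β - l'.β) / (l'.m - l.m), ?_⟩
  have h2 := h.2
  funext i
  fin_cases i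
  · simp only [pt]
    simp
    field_simp
    linear_combination (l'.m - l.m) * h2
  · rfl
  · simp only [pt]
    simp
    field_simp
    ring

theorem meets_of_pt_eq {l l' : NullLine K} (hm : l.m ≠ l'.m) {s s' : K}
    (h : l.pt s = l'.pt s') : l.Meets l' := by
  have h1 : s = s' := congrFun h 1
  subst h1
  have h0 : l.γ + l.m ^ 2 * s = l'.γ + l'.m ^ 2 * s := congrFun h 0
  have h2 : l.β + l.m * s = l'.β + l'.m * s := congrFun h 2
  exact ⟨hm, by linear_combination h0 - (l.m + l'.m) * h2⟩

/-- Two distinct null lines of the same slope have no common point. -/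
theorem eq_of_pt_eq {l l' : NullLine K} (hm : l.m = l'.m) {s s' : K}
    (h : l.pt s = l'.pt s') : l = l' := by
  rw [← through_pt l s, ← through_pt l' s', h, hm]

theorem totalDegree_pderiv_le (i : Fin 3) (P : MvPolynomial (Fin 3) K) :
    (pderiv i P).totalDegree ≤ P.totalDegree - 1 := by
  rw [totalDegree]
  apply Finset.sup_le
  intro b hb
  rw [mem_support_iff, coeff_pderiv] at hb
  have hb' : b + Finsupp.single i 1 ∈ P.support := by
    rw [mem_support_iff]
    intro h
    simp [h] at hb
  have := le_totalDegree hb'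
  rw [Finsupp.sum_add_index' (by simp) (by simp)] at this
  simp at this
  omega

theorem totalDegree_dir_le (m : K) (P : MvPolynomial (Fin 3) K) :
    (dir m P).totalDegree ≤ P.totalDegree - 1 := by
  rw [dir_apply]
  have h := fun i => totalDegree_pderiv_le i P
  refine (totalDegree_add _ _).trans (max_le ((totalDegree_add _ _).trans (max_le ?_ (h 1))) ?_)
  · exact (totalDegree_mul _ _).trans (by rw [totalDegree_C, zero_add]; exact h 0)
  · exact (totalDegree_mul _ _).trans (by simpa using h 2)

theorem not_dvd_of_totalDegree_lt {P Q : MvPolynomial (Fin 3) K} (hQ : Q ≠ 0)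
    (h : Q.totalDegree < P.totalDegree) : ¬ P ∣ Q := fun hd =>
  absurd (totalDegree_le_of_dvd_of_isDomain hd hQ) (not_le.2 h)

theorem totalDegree_pos_of_irreducible {P : MvPolynomial (Fin 3) K} (hP : Irreducible P) :
    0 < P.totalDegree := by
  rw [Nat.pos_iff_ne_zero]
  intro h
  have hC := totalDegree_eq_zero_iff_eq_C.1 h
  apply hP.not_isUnit
  rw [hC]
  apply IsUnit.map
  rw [isUnit_iff_ne_zero]
  intro h0
  rw [h0, C_0] at hC
  exact hP.ne_zero hC

theorem not_dvd_pderiv {P : MvPolynomial (Fin 3) K} (hP : Irreducible P) {i : Fin 3}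
    (h : pderiv i P ≠ 0) : ¬ P ∣ pderiv i P :=
  not_dvd_of_totalDegree_lt h (by
    have := totalDegree_pderiv_le i P
    have := totalDegree_pos_of_irreducible hP
    omega)

theorem exists_pderiv_ne_zero (p : ℕ) [CharP K p] {P : MvPolynomial (Fin 3) K}
    (hP : 0 < P.totalDegree) (hp : P.totalDegree < p) : ∃ i, pderiv i P ≠ 0 := by
  by_contra! hcon
  have : P.totalDegree ≤ 0 := by
    rw [totalDegree]
    apply Finset.sup_le
    intro b hb
    have hle := le_totalDegree hb
    have hb0 : b = 0 := by
      by_contra hb0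
      obtain ⟨i, hi⟩ := Finsupp.ne_iff.1 hb0
      have hi1 : 1 ≤ b i := Nat.one_le_iff_ne_zero.2 hi
      have hle' : b i ≤ P.totalDegree := by
        refine le_trans ?_ hle
        exact Finset.single_le_sum (f := fun i => b i) (fun _ _ => Nat.zero_le _)
          (Finsupp.mem_support_iff.2 hi)
      have h1 := congrArg (coeff (b - Finsupp.single i 1)) (hcon i)
      rw [coeff_pderiv, tsub_add_cancel_of_le (by simpa using hi1)] at h1
      rw [mem_support_iff] at hb
      simp [hb] at h1
      have h2 : ((b i : ℕ) : K) = 0 := by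
        have h3 : b i = (b i - 1) + 1 := by omega
        rw [h3]
        push_cast
        exact h1
      rw [CharP.cast_eq_zero_iff K p] at h2
      exact absurd (Nat.le_of_dvd hi1 h2) (by omega)
    simp [hb0]
  omega

end NullLine

namespace NullLine

open MvPolynomial

variable {K : Type*} [Field K]

theorem totalDegree_aeval_le {σ τ : Type*} (g : σ → MvPolynomial τ K)
    (hg : ∀ i, (g i).totalDegree ≤ 1) (P : MvPolynomial σ K) :
    (aeval g P).totalDegree ≤ P.totalDegree := by
  conv_lhs => rw [P.as_sum, map_sum]
  apply totalDegree_finsetSum_le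
  intro b hb
  rw [aeval_monomial]
  refine (totalDegree_mul _ _).trans ?_
  rw [algebraMap_eq, totalDegree_C, zero_add]
  refine (totalDegree_finsetProd _ _).trans (le_trans ?_ (le_totalDegree hb))
  apply Finset.sum_le_sum
  intro i _
  refine (totalDegree_pow _ _).trans ?_
  simpa using Nat.mul_le_mul_left (b i) (hg i)

theorem totalDegree_resultant_le {σ : Type*} (f g : Polynomial (MvPolynomial σ K)) (m n D : ℕ)
    (hf : ∀ i, (f.coeff i).totalDegree ≤ D) (hg : ∀ i, (g.coeff i).totalDegree ≤ D) :
    (f.resultant g m n).totalDegree ≤ (m + n) * D := by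
  rw [Polynomial.resultant, Matrix.det_apply]
  apply totalDegree_finsetSum_le
  intro τ _
  have h : ∀ a b, (f.sylvester g m n a b).totalDegree ≤ D := by
    intro a b
    simp only [Polynomial.sylvester, Matrix.of_apply]
    induction b using Fin.addCases with
    | left b =>
      rw [Fin.addCases_left]
      split_ifs
      · exact hg _
      · simp
    | right b =>
      rw [Fin.addCases_right]
      split_ifs
      · exact hf _
      · simp
  have h2 : (∏ i, f.sylvester g m n (τ i) i).totalDegree ≤ (m + n) * D := by
    refine (totalDegree_finsetProd _ _).trans ?_
    refine (Finset.sum_le_sum fun i _ => h (τ i) i).trans ?_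
    simp
  rcases Int.units_eq_one_or (Equiv.Perm.sign τ) with hs | hs
  · simpa [hs] using h2
  · simpa [hs, Units.smul_def] using h2

theorem isCoprime_map_of_not_dvd {R : Type*} [CommRing R] [IsDomain R] [UniqueFactorizationMonoid R]
    {f g : Polynomial R} (hf : Irreducible f) (hd : f.natDegree ≠ 0) (hfg : ¬ f ∣ g) :
    IsCoprime (f.map (algebraMap R (FractionRing R))) (g.map (algebraMap R (FractionRing R))) := by
  classical
  let _ := Classical.choice (inferInstance : Nonempty (NormalizedGCDMonoid R))
  have hirr := ((hf.isPrimitive hd).irreducible_iff_irreducible_map_fraction_map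
    (K := FractionRing R)).1 hf
  refine (EuclideanDomain.dvd_or_coprime _ _ hirr).resolve_left ?_
  rintro ⟨h, hh⟩
  obtain ⟨b, hb, hbh⟩ := IsLocalization.integerNormalization_spec (nonZeroDivisors R) h
  have hinj : Function.Injective (algebraMap R (FractionRing R)) := IsFractionRing.injective _ _
  have hmul : Polynomial.C b * g = f * IsLocalization.integerNormalization (nonZeroDivisors R) h := by
    apply Polynomial.map_injective _ hinj
    rw [Polynomial.map_mul, Polynomial.map_mul, hbh, hh, Polynomial.map_C, Algebra.smul_def,
      Polynomial.algebraMap_apply]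
    ring
  rcases hf.prime.dvd_or_dvd (hmul ▸ dvd_mul_right f _) with h1 | h1
  · apply hd
    have := Polynomial.natDegree_le_of_dvd h1 (Polynomial.C_ne_zero.2 (nonZeroDivisors.ne_zero hb))
    simpa using this
  · exact hfg h1

/-- Elimination of the first variable between an irreducible polynomial and a non-multiple of it. -/
theorem exists_eliminant {n : ℕ} {P T : MvPolynomial (Fin (n + 1)) K} (hP : Irreducible P)
    (hT : ¬ P ∣ T) :
    ∃ R : MvPolynomial (Fin n) K, R ≠ 0 ∧ R.totalDegree ≤ (P.totalDegree + T.totalDegree) ^ 2 ∧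
      ∀ (w : K) (v : Fin n → K), eval (Fin.cons w v : Fin (n + 1) → K) P = 0 →
        eval (Fin.cons w v : Fin (n + 1) → K) T = 0 → eval v R = 0 := by
  set f := finSuccEquiv K n P with hf
  set g := finSuccEquiv K n T with hg
  have hfi : Irreducible f := (MulEquiv.irreducible_iff (finSuccEquiv K n)).2 hP
  have hfg : ¬ f ∣ g := fun h => hT ((map_dvd_iff (finSuccEquiv K n)).1 h)
  have hcoeff : ∀ (Q : MvPolynomial (Fin (n + 1)) K) i,
      ((finSuccEquiv K n Q).coeff i).totalDegree ≤ Q.totalDegree := by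
    intro Q i
    by_cases h : (finSuccEquiv K n Q).coeff i = 0
    · simp [h]
    · have := totalDegree_coeff_finSuccEquiv_add_le Q i h
      omega
  have hdeg : ∀ Q : MvPolynomial (Fin (n + 1)) K,
      (finSuccEquiv K n Q).natDegree ≤ Q.totalDegree := fun Q => by
    rw [natDegree_finSuccEquiv]
    exact degreeOf_le_totalDegree Q 0
  by_cases hd : f.natDegree = 0
  · refine ⟨f.coeff 0, ?_, ?_, ?_⟩
    · intro h
      apply hfi.ne_zero
      rw [Polynomial.eq_C_of_natDegree_eq_zero hd, h, Polynomial.C_0]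
    · have h1 := hcoeff P 0
      nlinarith [Nat.zero_le P.totalDegree, Nat.zero_le T.totalDegree, Nat.le_self_pow two_ne_zero
        P.totalDegree]
    · intro w v h _
      rw [eval_eq_eval_mv_eval', ← hf, Polynomial.eq_C_of_natDegree_eq_zero hd] at h
      simpa using h
  · refine ⟨f.resultant g, ?_, ?_, ?_⟩
    · intro h
      have hc := isCoprime_map_of_not_dvd hfi hd hfg
      have h2 := congrArg (algebraMap _ (FractionRing (MvPolynomial (Fin n) K))) h
      have hinj : Function.Injective (algebraMap (MvPolynomial (Fin n) K)
        (FractionRing (MvPolynomial (Fin n) K))) := IsFractionRing.injective _ _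
      rw [← Polynomial.resultant_map_map, map_zero,
        ← Polynomial.natDegree_map_eq_of_injective hinj f,
        ← Polynomial.natDegree_map_eq_of_injective hinj g, Polynomial.resultant_eq_zero_iff] at h2
      exact h2.2 hc
    · refine (totalDegree_resultant_le f g _ _ (P.totalDegree + T.totalDegree)
        (fun i => (hcoeff P i).trans (Nat.le_add_right _ _))
        (fun i => (hcoeff T i).trans (Nat.le_add_left _ _))).trans ?_
      rw [sq]
      exact Nat.mul_le_mul_right _ (Nat.add_le_add (hdeg P) (hdeg T))
    · intro w v h1 h2
      obtain ⟨a, b, -, -, hab⟩ := Polynomial.exists_mul_add_mul_eq_C_resultant f g le_rfl le_rfl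
        (Or.inl hd)
      have := congrArg (fun q => Polynomial.eval w (Polynomial.map (eval v) q)) hab
      rw [eval_eq_eval_mv_eval', ← hf] at h1
      rw [eval_eq_eval_mv_eval', ← hg] at h2
      simpa [h1, h2] using this.symm

/-- The shear `z ↦ z - c w`. -/
noncomputable def shear (c : K) : MvPolynomial (Fin 3) K →ₐ[K] MvPolynomial (Fin 3) K :=
  aeval ![X 0, X 1, X 2 - C c * X 0]

theorem shear_shear_neg (c : K) (P : MvPolynomial (Fin 3) K) : shear c (shear (-c) P) = P := by
  have : (shear c).comp (shear (-c)) = AlgHom.id K _ := by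
    apply algHom_ext
    intro i
    fin_cases i <;> simp [shear]
  exact DFunLike.congr_fun this P

/-- The shear as an automorphism. -/
noncomputable def shearEquiv (c : K) : MvPolynomial (Fin 3) K ≃ₐ[K] MvPolynomial (Fin 3) K :=
  AlgEquiv.ofAlgHom (shear c) (shear (-c)) (AlgHom.ext fun P => shear_shear_neg c P)
    (AlgHom.ext fun P => by simpa using shear_shear_neg (-c) P)

theorem totalDegree_shear_le (c : K) (P : MvPolynomial (Fin 3) K) :
    (shear c P).totalDegree ≤ P.totalDegree := by
  apply totalDegree_aeval_le
  intro i
  fin_cases i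
  · simp
  · simp
  · refine (totalDegree_sub _ _).trans (max_le (by simp) ((totalDegree_mul _ _).trans (by simp)))

theorem eval_shear (c : K) (P : MvPolynomial (Fin 3) K) (w x z : K) :
    eval (Fin.cons w ![x, z + c * w] : Fin 3 → K) (shear c P) = eval ![w, x, z] P := by
  have : ((aeval (Fin.cons w ![x, z + c * w] : Fin 3 → K)).comp (shear c) :
      MvPolynomial (Fin 3) K →ₐ[K] K) = aeval ![w, x, z] := by
    apply algHom_ext
    intro i
    fin_cases i <;> simp [shear]
  simpa [aeval_eq_eval] using DFunLike.congr_fun this P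

/-- The number of null lines common to two surfaces without common component. -/
theorem card_le_of_on_of_on [Infinite K] {P T : MvPolynomial (Fin 3) K} (hP : Irreducible P)
    (hT : ¬ P ∣ T) (L : Finset (NullLine K)) (h1 : ∀ l ∈ L, l.On P) (h2 : ∀ l ∈ L, l.On T) :
    L.card ≤ (P.totalDegree + T.totalDegree) ^ 2 := by
  classical
  obtain ⟨c, hc⟩ : ∃ c : K, ∀ l ∈ L, ∀ l' ∈ L, l ≠ l' →
      l.m + c * l.m ^ 2 = l'.m + c * l'.m ^ 2 → l.β + c * l.γ ≠ l'.β + c * l'.γ := by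
    let q : NullLine K → NullLine K → Polynomial K := fun l l' =>
      if l.m = l'.m then Polynomial.C (l.β - l'.β) + Polynomial.C (l.γ - l'.γ) * Polynomial.X
      else Polynomial.C (l.m - l'.m) + Polynomial.C (l.m ^ 2 - l'.m ^ 2) * Polynomial.X
    have hq : ∏ t ∈ L.offDiag, q t.1 t.2 ≠ 0 := by
      rw [Finset.prod_ne_zero_iff]
      rintro ⟨l, l'⟩ ht h0
      rw [Finset.mem_offDiag] at ht
      simp only [q] at h0
      split_ifs at h0 with hm
      · have e0 := congrArg (fun u => Polynomial.coeff u 0) h0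
        have e1 := congrArg (fun u => Polynomial.coeff u 1) h0
        simp [sub_eq_zero] at e0 e1
        exact ht.2.2 (NullLine.ext hm e0 e1)
      · have e0 := congrArg (fun u => Polynomial.coeff u 0) h0
        simp [sub_eq_zero] at e0
        exact hm e0
    obtain ⟨c, hc⟩ : ∃ c, (∏ t ∈ L.offDiag, q t.1 t.2).eval c ≠ 0 := by
      by_contra! h
      exact hq (Polynomial.funext (by simpa using h))
    refine ⟨c, fun l hl l' hl' hne e1 e2 => hc ?_⟩
    rw [Polynomial.eval_prod]
    apply Finset.prod_eq_zero (Finset.mem_offDiag.2 ⟨hl, hl', hne⟩ : (l, l') ∈ L.offDiag)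
    simp only [q]
    split_ifs with hm
    · simp
      linear_combination e2
    · simp
      linear_combination e1
  have hP' : Irreducible (shear c P) := (MulEquiv.irreducible_iff (shearEquiv c)).2 hP
  have hT' : ¬ shear c P ∣ shear c T := fun h => hT ((map_dvd_iff (shearEquiv c)).1 h)
  obtain ⟨R, hR, hdeg, hvan⟩ := exists_eliminant hP' hT'
  let g : NullLine K → NullLine K → MvPolynomial (Fin 2) K := fun l l' =>
    C ((l.β + c * l.γ) - (l'.β + c * l'.γ)) +
      C ((l.m + c * l.m ^ 2) - (l'.m + c * l'.m ^ 2)) * X 0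
  have hg : R * ∏ t ∈ L.offDiag, g t.1 t.2 ≠ 0 := by
    refine mul_ne_zero hR ?_
    rw [Finset.prod_ne_zero_iff]
    rintro ⟨l, l'⟩ ht h0
    rw [Finset.mem_offDiag] at ht
    have e0 := congrArg (eval ![(0 : K), 0]) h0
    have e1 := congrArg (eval ![(1 : K), 0]) h0
    simp [g] at e0 e1
    exact hc l ht.1 l' ht.2.1 ht.2.2 (by linear_combination e1 - e0) (by linear_combination e0)
  obtain ⟨v, hv⟩ : ∃ v, eval v (R * ∏ t ∈ L.offDiag, g t.1 t.2) ≠ 0 := by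
    by_contra! h
    exact hg (MvPolynomial.funext (by simpa using h))
  rw [map_mul, map_prod, mul_ne_zero_iff, Finset.prod_ne_zero_iff] at hv
  let r : Polynomial K := aeval ![Polynomial.C (v 0), Polynomial.X] R
  have hr : ∀ t, r.eval t = eval ![v 0, t] R := by
    intro t
    have : ((Polynomial.aeval t).comp (aeval ![Polynomial.C (v 0), Polynomial.X]) :
        MvPolynomial (Fin 2) K →ₐ[K] K) = aeval ![v 0, t] := by
      apply algHom_ext
      intro i
      fin_cases i <;> simp
    simpa [aeval_eq_eval, Polynomial.aeval_def, Polynomial.eval₂_eq_eval_map] using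
      DFunLike.congr_fun this R
  have hr0 : r ≠ 0 := by
    intro h
    have h3 := hr (v 1)
    rw [h, Polynomial.eval_zero] at h3
    apply hv.1
    rw [h3]
    congr 1
    congr 1
    funext i
    fin_cases i <;> rfl
  have hrdeg : r.natDegree ≤ R.totalDegree := by
    have := MvPolynomial.aeval_natDegree_le (n := 1) R le_rfl ![Polynomial.C (v 0), Polynomial.X] (by
      intro i
      fin_cases i <;> simp)
    simpa using this
  let ρ : NullLine K → K := fun l => (l.β + c * l.γ) + (l.m + c * l.m ^ 2) * v 0
  have hρ : Set.InjOn ρ L := by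
    intro l hl l' hl' h
    by_contra hne
    apply hv.2 (l, l') (Finset.mem_offDiag.2 ⟨hl, hl', hne⟩)
    simp [g]
    linear_combination h
  rw [← Finset.card_image_of_injOn hρ]
  have hroots : (L.image ρ).card ≤ r.natDegree := by
    apply Polynomial.card_le_degree_of_subset_roots
    intro t ht
    simp only [Finset.mem_val, Finset.mem_image] at ht
    obtain ⟨l, hl, rfl⟩ := ht
    rw [Polynomial.mem_roots hr0, Polynomial.IsRoot, hr]
    have e1 := (h1 l hl).eval_eq_zero (v 0)
    have e2 := (h2 l hl).eval_eq_zero (v 0)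
    rw [pt, ← eval_shear c] at e1 e2
    have := hvan _ _ e1 e2
    convert this using 3
    simp [ρ]
    ring
  refine hroots.trans (hrdeg.trans (hdeg.trans ?_))
  exact Nat.pow_le_pow_left (Nat.add_le_add (totalDegree_shear_le c P) (totalDegree_shear_le c T)) 2

end NullLine

namespace NullLine

open MvPolynomial

variable {K : Type*} [Field K]

/-- An irreducible surface containing infinitely many common null lines with `T = 0` divides `T`. -/
theorem dvd_of_infinite [Infinite K] {P T : MvPolynomial (Fin 3) K} (hP : Irreducible P)
    (h : {l : NullLine K | l.On P ∧ l.On T}.Infinite) : P ∣ T := by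
  by_contra hT
  obtain ⟨L, hL, hcard⟩ := h.exists_subset_card_eq ((P.totalDegree + T.totalDegree) ^ 2 + 1)
  have := card_le_of_on_of_on hP hT L (fun l hl => (hL hl).1) (fun l hl => (hL hl).2)
  omega

/-- A polynomial of small degree solving a linear second order equation with vanishing initial
data is zero. -/
theorem eq_zero_of_ode (p : ℕ) [CharP K p] {f A B q : Polynomial K} (hp : f.natDegree < p) {s : K}
    (h0 : f.eval s = 0) (h1 : f.derivative.eval s = 0) (hq : q.eval s ≠ 0)
    (h : q * f.derivative.derivative = A * f.derivative + B * f) : f = 0 := by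
  by_contra hf
  have hk : 1 < f.rootMultiplicity s := by
    rw [Polynomial.one_lt_rootMultiplicity_iff_isRoot hf]
    exact ⟨h0, h1⟩
  obtain ⟨j, hj⟩ : ∃ j, f.rootMultiplicity s = j + 2 := ⟨f.rootMultiplicity s - 2, by omega⟩
  obtain ⟨g, hfg, hg⟩ := Polynomial.exists_eq_pow_rootMultiplicity_mul_and_not_dvd f hf s
  rw [hj] at hfg
  rw [Polynomial.dvd_iff_isRoot, Polynomial.IsRoot] at hg
  have hg0 : g ≠ 0 := fun h => hg (by simp [h])
  have hle : j + 2 ≤ f.natDegree := by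
    rw [hfg, Polynomial.natDegree_mul (pow_ne_zero _ (Polynomial.X_sub_C_ne_zero s)) hg0,
      Polynomial.natDegree_pow, Polynomial.natDegree_X_sub_C]
    omega
  set u : Polynomial K := Polynomial.X - Polynomial.C s with hu
  have hu' : Polynomial.derivative u = 1 := by simp [hu]
  have hpow : ∀ (i : ℕ) (r : Polynomial K), Polynomial.derivative (u ^ (i + 1) * r) =
      u ^ i * (((i : Polynomial K) + 1) * r + u * r.derivative) := by
    intro i r
    rw [Polynomial.derivative_mul, Polynomial.derivative_pow, hu']
    simp
    ring
  obtain ⟨g₁, hg₁⟩ : ∃ g₁, g₁ = (((j + 1 : ℕ) : Polynomial K) + 1) * g + u * g.derivative :=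
    ⟨_, rfl⟩
  have e1 : f.derivative = u ^ (j + 1) * g₁ := by
    rw [hfg, hg₁]
    exact hpow (j + 1) g
  have e2 : f.derivative.derivative = u ^ j * (((j : Polynomial K) + 1) * g₁ + u * g₁.derivative) := by
    rw [e1]
    exact hpow j g₁
  rw [e2, e1, hfg] at h
  have hu0 : u ^ j ≠ 0 := pow_ne_zero _ (Polynomial.X_sub_C_ne_zero s)
  have h2 : q * (((j : Polynomial K) + 1) * g₁ + u * g₁.derivative) =
      u * (A * g₁ + B * (u * g)) := by
    apply mul_left_cancel₀ hu0
    linear_combination h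
  have h3 := congrArg (Polynomial.eval s) h2
  have hus : u.eval s = 0 := by simp [hu]
  simp [hq, hg, hus, hg₁] at h3
  have hcast : ∀ n : ℕ, 0 < n → n < p → (n : K) ≠ 0 := by
    intro n hn hnp h
    rw [CharP.cast_eq_zero_iff K p] at h
    exact absurd (Nat.le_of_dvd hn h) (by omega)
  rcases h3 with h3 | h3
  · exact hcast (j + 1) (by omega) (by omega) (by exact_mod_cast h3)
  · exact hcast (j + 1 + 1) (by omega) (by omega) (by exact_mod_cast h3)

/-- Vanishing of `z - m x - β`, one of the two equations of a null line. -/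
noncomputable def eqZ (l : NullLine K) : MvPolynomial (Fin 3) K := X 2 - C l.m * X 1 - C l.β

/-- Vanishing of `w - m z - (γ - m β)`, one of the two equations of a null line. -/
noncomputable def eqU (l : NullLine K) : MvPolynomial (Fin 3) K :=
  X 0 - C l.m * X 2 - C (l.γ - l.m * l.β)

theorem Meets.restr_eqU {l c : NullLine K} (h : c.Meets l) :
    restr c (eqU l) = Polynomial.C c.m * restr c (eqZ l) := by
  have h2 : (Polynomial.C c.γ : Polynomial K) = Polynomial.C l.γ +
      (Polynomial.C c.m + Polynomial.C l.m) * (Polynomial.C c.β - Polynomial.C l.β) := by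
    rw [← sub_eq_iff_eq_add', ← Polynomial.C_sub, h.2]
    simp
  simp [restr, eqU, eqZ]
  rw [h2]
  ring

/-- The cone condition: if all null lines through a point meet `l` then this form vanishes. -/
noncomputable def coneForm (P : MvPolynomial (Fin 3) K) (l : NullLine K) : MvPolynomial (Fin 3) K :=
  pderiv 1 P * eqZ l ^ 2 + pderiv 2 P * (eqZ l * eqU l) + pderiv 0 P * eqU l ^ 2

theorem Meets.on_coneForm {l c : NullLine K} {P : MvPolynomial (Fin 3) K} (h : c.Meets l)
    (hc : c.On P) : c.On (coneForm P l) := by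
  have h1 : restr c (NullLine.dir c.m P) = 0 := hc.dir
  rw [dir_apply] at h1
  have hC : ∀ a : K, restr c (C a) = Polynomial.C a := fun a => by simp [restr]
  simp only [map_add, map_mul, hC] at h1
  simp only [On, coneForm, map_add, map_mul, map_pow, h.restr_eqU]
  rw [Polynomial.C_pow] at h1
  linear_combination (restr c (eqZ l)) ^ 2 * h1

theorem totalDegree_eqZ_le (l : NullLine K) : (eqZ l).totalDegree ≤ 1 := by
  refine (totalDegree_sub _ _).trans (max_le ((totalDegree_sub _ _).trans (max_le (by simp)
    ((totalDegree_mul _ _).trans (by simp)))) (by simp))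

theorem totalDegree_eqU_le (l : NullLine K) : (eqU l).totalDegree ≤ 1 := by
  refine (totalDegree_sub _ _).trans (max_le ((totalDegree_sub _ _).trans (max_le (by simp)
    ((totalDegree_mul _ _).trans (by simp)))) (by rw [totalDegree_C]; exact Nat.zero_le _))

theorem totalDegree_regulus_le (l l' : NullLine K) :
    (eqZ l * eqU l' - eqZ l' * eqU l).totalDegree ≤ 2 :=
  (totalDegree_sub _ _).trans (max_le
    ((totalDegree_mul _ _).trans (Nat.add_le_add (totalDegree_eqZ_le l) (totalDegree_eqU_le l')))
    ((totalDegree_mul _ _).trans (Nat.add_le_add (totalDegree_eqZ_le l') (totalDegree_eqU_le l))))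

theorem regulus_ne_zero {l l' : NullLine K} (h : l ≠ l') :
    eqZ l * eqU l' - eqZ l' * eqU l ≠ 0 := by
  intro h0
  apply h
  have e := fun w x z : K => congrArg (eval ![w, x, z]) h0
  simp [eqZ, eqU] at e
  have e0 := e 0 0 0
  have e1 := e 1 0 0
  have e2 := e 1 1 0
  have e3 := e 0 1 0
  have e4 := e 0 0 1
  have e5 := e 0 0 (-1)
  have hm : l.m = l'.m := by linear_combination (-1 : K) * (e2 - e1 - e3 + e0)
  have hβ : l.β = l'.β := by linear_combination (-1 : K) * (e1 - e0)
  rw [hm, hβ] at e4 e0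
  refine NullLine.ext hm hβ ?_
  linear_combination e4 - e0

/-- A surface ruled by null lines in two ways has degree at most two. -/
theorem totalDegree_le_two_of_doubly_ruled {P : MvPolynomial (Fin 3) K} (hP : Irreducible P)
    (ha : ¬ P ∣ pderiv 0 P) {l₁ l₂ l₃ : NullLine K} (h12 : l₁ ≠ l₂) (h13 : l₁ ≠ l₃)
    (h23 : l₂ ≠ l₃) (h1 : P ∣ coneForm P l₁) (h2 : P ∣ coneForm P l₂) (h3 : P ∣ coneForm P l₃) :
    P.totalDegree ≤ 2 := by
  have key : P ∣ ((eqZ l₁ * eqU l₂ - eqZ l₂ * eqU l₁) * (eqZ l₁ * eqU l₃ - eqZ l₃ * eqU l₁) *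
      (eqZ l₂ * eqU l₃ - eqZ l₃ * eqU l₂)) * pderiv 0 P := by
    have : ((eqZ l₁ * eqU l₂ - eqZ l₂ * eqU l₁) * (eqZ l₁ * eqU l₃ - eqZ l₃ * eqU l₁) *
      (eqZ l₂ * eqU l₃ - eqZ l₃ * eqU l₂)) * pderiv 0 P =
      coneForm P l₁ * (eqZ l₂ * eqZ l₃ * (eqZ l₂ * eqU l₃ - eqZ l₃ * eqU l₂)) -
      coneForm P l₂ * (eqZ l₁ * eqZ l₃ * (eqZ l₁ * eqU l₃ - eqZ l₃ * eqU l₁)) +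
      coneForm P l₃ * (eqZ l₁ * eqZ l₂ * (eqZ l₁ * eqU l₂ - eqZ l₂ * eqU l₁)) := by
      simp only [coneForm]
      ring
    rw [this]
    exact dvd_add (dvd_sub (h1.mul_right _) (h2.mul_right _)) (h3.mul_right _)
  have main : ∀ l l' : NullLine K, l ≠ l' → P ∣ eqZ l * eqU l' - eqZ l' * eqU l →
      P.totalDegree ≤ 2 := fun l l' hne hd =>
    (totalDegree_le_of_dvd_of_isDomain hd (regulus_ne_zero hne)).trans (totalDegree_regulus_le l l')
  rcases hP.prime.dvd_or_dvd key with h | h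
  · rcases hP.prime.dvd_or_dvd h with h | h
    · rcases hP.prime.dvd_or_dvd h with h | h
      · exact main _ _ h12 h
      · exact main _ _ h13 h
    · exact main _ _ h23 h
  · exact absurd h ha

end NullLine

namespace NullLine

open MvPolynomial

variable {K : Type*} [Field K]

/-- The quadratic satisfied by the slopes of null lines on `P = 0` through a point. -/
theorem On.quadratic {l : NullLine K} {P : MvPolynomial (Fin 3) K} (h : l.On P) (s : K) :
    eval (l.pt s) (pderiv 0 P) * l.m ^ 2 + eval (l.pt s) (pderiv 2 P) * l.m +
      eval (l.pt s) (pderiv 1 P) = 0 := by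
  have := h.dir.eval_eq_zero s
  rw [dir_apply] at this
  simp at this
  linear_combination this

section Hessian

variable (P : MvPolynomial (Fin 3) K)

/-- Coefficient of `m ^ 3` in the second derivative of `P` along null lines of slope `m`. -/
noncomputable def hess3 : MvPolynomial (Fin 3) K := pderiv 0 (pderiv 2 P) + pderiv 2 (pderiv 0 P)

/-- Coefficient of `m ^ 2` in the second derivative of `P` along null lines of slope `m`. -/
noncomputable def hess2 : MvPolynomial (Fin 3) K :=
  pderiv 0 (pderiv 1 P) + pderiv 1 (pderiv 0 P) + pderiv 2 (pderiv 2 P)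

/-- Coefficient of `m` in the second derivative of `P` along null lines of slope `m`. -/
noncomputable def hess1 : MvPolynomial (Fin 3) K := pderiv 1 (pderiv 2 P) + pderiv 2 (pderiv 1 P)

/-- Constant coefficient of the remainder on dividing the second derivative by the first. -/
noncomputable def rem0 : MvPolynomial (Fin 3) K :=
  pderiv 0 P * hess3 P * pderiv 2 P * pderiv 1 P + pderiv 0 P ^ 3 * pderiv 1 (pderiv 1 P) -
    pderiv 0 (pderiv 0 P) * pderiv 1 P * (pderiv 2 P ^ 2 - pderiv 0 P * pderiv 1 P) -
    pderiv 0 P ^ 2 * pderiv 1 P * hess2 P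

/-- Linear coefficient of the remainder on dividing the second derivative by the first. -/
noncomputable def rem1 : MvPolynomial (Fin 3) K :=
  pderiv 0 (pderiv 0 P) * (pderiv 0 P * pderiv 2 P * pderiv 1 P + pderiv 0 P * pderiv 2 P *
    pderiv 1 P - pderiv 2 P ^ 3) + pderiv 0 P * hess3 P * (pderiv 2 P ^ 2 - pderiv 0 P * pderiv 1 P)
    - pderiv 0 P ^ 2 * pderiv 2 P * hess2 P + pderiv 0 P ^ 3 * hess1 P

/-- The quotient on dividing the second derivative by the first. -/
noncomputable def quot (m : K) : MvPolynomial (Fin 3) K :=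
  pderiv 0 P ^ 2 * pderiv 0 (pderiv 0 P) * C m ^ 2 +
    (pderiv 0 P ^ 2 * hess3 P - pderiv 0 P * pderiv 2 P * pderiv 0 (pderiv 0 P)) * C m +
    (pderiv 0 P ^ 2 * hess2 P - pderiv 0 P * pderiv 2 P * hess3 P +
      (pderiv 2 P ^ 2 - pderiv 0 P * pderiv 1 P) * pderiv 0 (pderiv 0 P))

/-- The discriminant of the quadratic satisfied by the slopes. -/
noncomputable def slopeDiscr : MvPolynomial (Fin 3) K :=
  pderiv 2 P ^ 2 - C 4 * (pderiv 0 P * pderiv 1 P)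

theorem dir_dir (m : K) :
    pderiv 0 P ^ 3 * dir m (dir m P) = quot P m * dir m P + (rem1 P * C m + rem0 P) := by
  simp only [dir_apply, map_add, Derivation.leibniz, smul_eq_mul, pderiv_C, mul_zero, add_zero,
    quot, rem1, rem0, hess1, hess2, hess3]
  rw [C_pow]
  ring

variable {P} {d : ℕ}

theorem totalDegree_mul_le {f g : MvPolynomial (Fin 3) K} {i j : ℕ} (hf : f.totalDegree ≤ i)
    (hg : g.totalDegree ≤ j) : (f * g).totalDegree ≤ i + j :=
  (totalDegree_mul f g).trans (Nat.add_le_add hf hg)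

theorem totalDegree_add_le {f g : MvPolynomial (Fin 3) K} {i : ℕ} (hf : f.totalDegree ≤ i)
    (hg : g.totalDegree ≤ i) : (f + g).totalDegree ≤ i :=
  (totalDegree_add f g).trans (max_le hf hg)

theorem totalDegree_sub_le {f g : MvPolynomial (Fin 3) K} {i : ℕ} (hf : f.totalDegree ≤ i)
    (hg : g.totalDegree ≤ i) : (f - g).totalDegree ≤ i :=
  (totalDegree_sub f g).trans (max_le hf hg)

theorem totalDegree_pderiv_le' {f : MvPolynomial (Fin 3) K} (i : Fin 3) (hf : f.totalDegree ≤ d) :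
    (pderiv i f).totalDegree ≤ d :=
  (totalDegree_pderiv_le i f).trans ((Nat.sub_le _ _).trans hf)

theorem totalDegree_rem0_le (hP : P.totalDegree ≤ d) : (rem0 P).totalDegree ≤ 4 * d := by
  have h1 := fun i => totalDegree_pderiv_le' i hP
  have h2 := fun i j => totalDegree_pderiv_le' i (h1 j)
  have e : 4 * d = d + d + d + d := by ring
  have hh2 : (hess2 P).totalDegree ≤ d :=
    totalDegree_add_le (totalDegree_add_le (h2 _ _) (h2 _ _)) (h2 _ _)
  have hh3 : (hess3 P).totalDegree ≤ d := totalDegree_add_le (h2 _ _) (h2 _ _)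
  rw [e]
  simp only [rem0, pow_succ, pow_zero, one_mul]
  refine totalDegree_sub_le (totalDegree_sub_le (totalDegree_add_le ?_ ?_) ?_) ?_
  · exact totalDegree_mul_le (totalDegree_mul_le (totalDegree_mul_le (h1 _) hh3) (h1 _)) (h1 _)
  · exact totalDegree_mul_le (totalDegree_mul_le (totalDegree_mul_le (h1 _) (h1 _)) (h1 _)) (h2 _ _)
  · rw [add_assoc (d + d)]
    exact totalDegree_mul_le (totalDegree_mul_le (h2 _ _) (h1 _))
      (totalDegree_sub_le (totalDegree_mul_le (h1 _) (h1 _)) (totalDegree_mul_le (h1 _) (h1 _)))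
  · exact totalDegree_mul_le (totalDegree_mul_le (totalDegree_mul_le (h1 _) (h1 _)) (h1 _)) hh2

theorem totalDegree_rem1_le (hP : P.totalDegree ≤ d) : (rem1 P).totalDegree ≤ 4 * d := by
  have h1 := fun i => totalDegree_pderiv_le' i hP
  have h2 := fun i j => totalDegree_pderiv_le' i (h1 j)
  have e : 4 * d = d + d + d + d := by ring
  have hh1 : (hess1 P).totalDegree ≤ d := totalDegree_add_le (h2 _ _) (h2 _ _)
  have hh2 : (hess2 P).totalDegree ≤ d :=
    totalDegree_add_le (totalDegree_add_le (h2 _ _) (h2 _ _)) (h2 _ _)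
  have hh3 : (hess3 P).totalDegree ≤ d := totalDegree_add_le (h2 _ _) (h2 _ _)
  have h3 : ∀ i j k, (pderiv i P * pderiv j P * pderiv k P).totalDegree ≤ d + d + d := fun i j k =>
    totalDegree_mul_le (totalDegree_mul_le (h1 _) (h1 _)) (h1 _)
  rw [e]
  simp only [rem1, pow_succ, pow_zero, one_mul]
  refine totalDegree_add_le (totalDegree_sub_le (totalDegree_add_le ?_ ?_) ?_) ?_
  · rw [add_assoc, add_assoc d]
    refine totalDegree_mul_le (h2 _ _) ?_
    rw [← add_assoc]
    exact totalDegree_sub_le (totalDegree_add_le (h3 _ _ _) (h3 _ _ _)) (h3 _ _ _)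
  · rw [add_assoc (d + d)]
    exact totalDegree_mul_le (totalDegree_mul_le (h1 _) hh3)
      (totalDegree_sub_le (totalDegree_mul_le (h1 _) (h1 _)) (totalDegree_mul_le (h1 _) (h1 _)))
  · exact totalDegree_mul_le (h3 _ _ _) hh2
  · exact totalDegree_mul_le (h3 _ _ _) hh1

theorem totalDegree_slopeDiscr_le (hP : P.totalDegree ≤ d) : (slopeDiscr P).totalDegree ≤ 2 * d := by
  have h1 := fun i => totalDegree_pderiv_le' i hP
  have e : 2 * d = d + d := by ring
  rw [slopeDiscr, e, sq]
  refine totalDegree_sub_le (totalDegree_mul_le (h1 _) (h1 _)) ?_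
  rw [← zero_add (d + d)]
  exact totalDegree_mul_le (by simp) (totalDegree_mul_le (h1 _) (h1 _))

/-- Both remainder coefficients vanish where two null lines on `P = 0` cross. -/
theorem On.rem_eq_zero {l l' : NullLine K} (hl : l.On P) (hl' : l'.On P) (hm : l.m ≠ l'.m) {s : K}
    (h : l.pt s = l'.pt s) : eval (l.pt s) (rem0 P) = 0 ∧ eval (l.pt s) (rem1 P) = 0 := by
  have key : ∀ l : NullLine K, l.On P →
      eval (l.pt s) (rem1 P) * l.m + eval (l.pt s) (rem0 P) = 0 := by
    intro l hl
    have e := congrArg (eval (l.pt s)) (dir_dir P l.m)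
    have e1 := hl.dir.eval_eq_zero s
    have e2 := hl.dir.dir.eval_eq_zero s
    simp only [map_add, map_mul, e1, e2, eval_C, mul_zero, zero_add] at e
    exact e.symm
  have k1 := key l hl
  have k2 := key l' hl'
  rw [← h] at k2
  have h1 : eval (l.pt s) (rem1 P) = 0 := by
    apply (mul_eq_zero.1 (_ : eval (l.pt s) (rem1 P) * (l.m - l'.m) = 0)).resolve_right
      (sub_ne_zero.2 hm)
    linear_combination k1 - k2
  refine ⟨?_, h1⟩
  rw [h1] at k1
  linear_combination k1

/-- If the remainders vanish on `P = 0`, tangent null lines at nondegenerate points are contained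
in `P = 0`. -/
theorem on_of_tangent (p : ℕ) [CharP K p] (hd : P.totalDegree < p) (h0 : P ∣ rem0 P)
    (h1 : P ∣ rem1 P) {l : NullLine K} {s : K} (e0 : eval (l.pt s) P = 0)
    (e1 : eval (l.pt s) (dir l.m P) = 0) (ha : eval (l.pt s) (pderiv 0 P) ≠ 0) : l.On P := by
  obtain ⟨B, hB⟩ : P ∣ rem1 P * C l.m + rem0 P := dvd_add (h1.mul_right _) h0
  refine eq_zero_of_ode p (f := restr l P) (A := restr l (quot P l.m)) (B := restr l B)
    (q := restr l (pderiv 0 P ^ 3)) (s := s) ((natDegree_restr_le l P).trans_lt hd) ?_ ?_ ?_ ?_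
  · rwa [eval_restr]
  · rwa [derivative_restr, eval_restr]
  · rw [eval_restr, map_pow]
    exact pow_ne_zero _ ha
  · rw [derivative_restr, derivative_restr, ← map_mul, dir_dir, hB, map_add, map_mul, map_mul]
    ring

/-- At all but finitely many points of a nondegenerate line there is a crossing line. -/
theorem infinite_crossing [Infinite K] (p : ℕ) [CharP K p] (hd : P.totalDegree < p)
    (h0 : P ∣ rem0 P) (h1 : P ∣ rem1 P) {l : NullLine K} (hl : l.On P)
    (hn : ¬ l.On (slopeDiscr P * pderiv 0 P)) :
    {c : NullLine K | c.On P ∧ ¬ c.On (slopeDiscr P * pderiv 0 P) ∧ c.Meets l}.Infinite := by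
  have hfin : {s | eval (l.pt s) (slopeDiscr P * pderiv 0 P) ≠ 0}.Infinite := by
    have : {s | eval (l.pt s) (slopeDiscr P * pderiv 0 P) = 0}.Finite := by
      by_contra h
      exact hn (on_of_infinite h)
    exact this.infinite_compl
  let μ : K → K := fun s =>
    -(eval (l.pt s) (pderiv 2 P) / eval (l.pt s) (pderiv 0 P)) - l.m
  have hμ : ∀ s, eval (l.pt s) (slopeDiscr P * pderiv 0 P) ≠ 0 → μ s ≠ l.m := by
    intro s hs h
    rw [map_mul, mul_ne_zero_iff] at hs
    apply hs.1
    have hq := hl.quadratic s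
    have ha := hs.2
    simp only [μ] at h
    field_simp at h
    simp only [slopeDiscr, map_sub, map_pow, map_mul, eval_C]
    generalize eval (l.pt s) (pderiv 0 P) = a at *
    generalize eval (l.pt s) (pderiv 1 P) = c at *
    generalize eval (l.pt s) (pderiv 2 P) = b at *
    have hb : b = -(2 * a * l.m) := by linear_combination -h
    rw [hb] at hq ⊢
    linear_combination (-4 * a) * hq
  have hinj : Set.InjOn (fun s => through (l.pt s) (μ s))
      {s | eval (l.pt s) (slopeDiscr P * pderiv 0 P) ≠ 0} := by
    intro s hs t _ h
    by_contra hne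
    apply hμ s hs
    have hm : μ s = μ t := congrArg NullLine.m h
    have hβ : l.β + l.m * s - μ s * s = l.β + l.m * t - μ t * t := congrArg NullLine.β h
    rw [← hm] at hβ
    have : (l.m - μ s) * (s - t) = 0 := by linear_combination hβ
    rcases mul_eq_zero.1 this with h3 | h3
    · exact (sub_eq_zero.1 h3).symm
    · exact absurd (sub_eq_zero.1 h3) hne
  refine (hfin.image hinj).mono ?_
  rintro _ ⟨s, hs, rfl⟩
  have hpt : (through (l.pt s) (μ s)).pt s = l.pt s := pt_through (l.pt s) (μ s)
  refine ⟨?_, ?_, ?_⟩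
  · have ha : eval (l.pt s) (pderiv 0 P) ≠ 0 := by
      intro h
      apply hs
      simp [h]
    apply on_of_tangent p hd h0 h1 (s := s)
    · rw [hpt]
      exact hl.eval_eq_zero s
    · have hq := hl.quadratic s
      rw [hpt, dir_apply]
      simp only [map_add, map_mul, eval_C, through, μ]
      field_simp
      linear_combination (eval (l.pt s) (pderiv 0 P)) * hq
    · rwa [hpt]
  · intro h
    apply hs
    have := h.eval_eq_zero s
    rwa [hpt] at this
  · exact meets_of_pt_eq (hμ s hs) hpt

/-- An irreducible surface of small degree and greater than two carries a nontrivial polynomial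
vanishing at all crossings of its null lines. -/
theorem exists_crossing_polynomial [Infinite K] (p : ℕ) [CharP K p] (hP : Irreducible P)
    (hd : P.totalDegree < p) (h2 : 2 < P.totalDegree) :
    ∃ T : MvPolynomial (Fin 3) K, ¬ P ∣ T ∧ T.totalDegree ≤ 4 * P.totalDegree ∧
      ∀ l l' : NullLine K, l.On P → l'.On P → l.m ≠ l'.m → ∀ s, l.pt s = l'.pt s →
        eval (l.pt s) T = 0 := by
  have h1 : ∀ i, (pderiv i P).totalDegree ≤ 4 * P.totalDegree := fun i =>
    (totalDegree_pderiv_le' i le_rfl).trans (by omega)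
  by_cases ha : pderiv 0 P = 0
  · have hbc : ∀ l l' : NullLine K, l.On P → l'.On P → l.m ≠ l'.m → ∀ s, l.pt s = l'.pt s →
        eval (l.pt s) (pderiv 2 P) = 0 ∧ eval (l.pt s) (pderiv 1 P) = 0 := by
      intro l l' hl hl' hm s h
      have k1 := hl.quadratic s
      have k2 := hl'.quadratic s
      rw [← h] at k2
      rw [ha, map_zero] at k1 k2
      have h1 : eval (l.pt s) (pderiv 2 P) = 0 := by
        apply (mul_eq_zero.1 (_ : eval (l.pt s) (pderiv 2 P) * (l.m - l'.m) = 0)).resolve_right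
          (sub_ne_zero.2 hm)
        linear_combination k1 - k2
      refine ⟨h1, ?_⟩
      rw [h1] at k1
      linear_combination k1
    obtain ⟨i, hi⟩ := exists_pderiv_ne_zero p (by omega) hd
    refine ⟨pderiv i P, not_dvd_pderiv hP hi, h1 i, ?_⟩
    intro l l' hl hl' hm s h
    have := hbc l l' hl hl' hm s h
    fin_cases i
    · exact absurd ha hi
    · exact this.2
    · exact this.1
  have hna := not_dvd_pderiv hP ha
  by_cases hr0 : P ∣ rem0 P
  swap
  · exact ⟨_, hr0, totalDegree_rem0_le le_rfl, fun l l' hl hl' hm s h =>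
      (hl.rem_eq_zero hl' hm h).1⟩
  by_cases hr1 : P ∣ rem1 P
  swap
  · exact ⟨_, hr1, totalDegree_rem1_le le_rfl, fun l l' hl hl' hm s h =>
      (hl.rem_eq_zero hl' hm h).2⟩
  by_cases hD : P ∣ slopeDiscr P
  · refine ⟨_, hna, h1 0, ?_⟩
    intro l l' hl hl' hm s h
    have k1 := hl.quadratic s
    have k2 := hl'.quadratic s
    have hDl := (hl.of_dvd hD).eval_eq_zero s
    rw [← h] at k2
    simp only [slopeDiscr, map_sub, map_pow, map_mul, eval_C] at hDl
    generalize eval (l.pt s) (pderiv 0 P) = a at *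
    generalize eval (l.pt s) (pderiv 1 P) = c at *
    generalize eval (l.pt s) (pderiv 2 P) = b at *
    have hm' := sub_ne_zero.2 hm
    have e1 : a * (l.m + l'.m) + b = 0 := by
      apply (mul_eq_zero.1 (_ : (l.m - l'.m) * (a * (l.m + l'.m) + b) = 0)).resolve_left hm'
      linear_combination k1 - k2
    have e2 : (a * (l.m - l'.m)) ^ 2 = 0 := by
      have hb : b = -(a * (l.m + l'.m)) := by linear_combination e1
      rw [hb] at hDl k1
      linear_combination hDl + 4 * a * k1
    exact (mul_eq_zero.1 (pow_eq_zero_iff two_ne_zero |>.1 e2)).resolve_right hm'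
  refine ⟨slopeDiscr P * pderiv 0 P, fun h => (hP.prime.dvd_or_dvd h).elim hD hna, ?_, ?_⟩
  · refine (totalDegree_mul_le (totalDegree_slopeDiscr_le le_rfl)
      (totalDegree_pderiv_le' 0 le_rfl)).trans (by omega)
  intro l l' hl _ _ s _
  by_contra hs
  have hn : ¬ l.On (slopeDiscr P * pderiv 0 P) := fun h => hs (h.eval_eq_zero s)
  have hcone : ∀ c : NullLine K, c.On P → ¬ c.On (slopeDiscr P * pderiv 0 P) →
      P ∣ coneForm P c := fun c hc hcn =>
    dvd_of_infinite hP ((infinite_crossing p hd hr0 hr1 hc hcn).mono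
      fun e he => ⟨he.1, he.2.2.on_coneForm he.1⟩)
  classical
  obtain ⟨S, hS, hcard⟩ := (infinite_crossing p hd hr0 hr1 hl hn).exists_subset_card_eq 3
  obtain ⟨c₁, c₂, c₃, h12, h13, h23, rfl⟩ := Finset.card_eq_three.1 hcard
  have k1 := @hS c₁ (by simp)
  have k2 := @hS c₂ (by simp)
  have k3 := @hS c₃ (by simp)
  exact absurd (totalDegree_le_two_of_doubly_ruled hP hna h12 h13 h23 (hcone _ k1.1 k1.2.1)
    (hcone _ k2.1 k2.2.1) (hcone _ k3.1 k3.2.1)) (by omega)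

end Hessian

end NullLine

namespace NullLine

open MvPolynomial

variable {K : Type*} [Field K]

/-- The equation of a plane spanned by null lines of slopes `m` and `n`. -/
noncomputable def planeEq (m n c : K) : MvPolynomial (Fin 3) K :=
  X 0 - C (m + n) * X 2 + C (m * n) * X 1 - C c

theorem restr_planeEq (m n c : K) (l : NullLine K) :
    restr l (planeEq m n c) = Polynomial.C (l.γ - (m + n) * l.β - c) +
      Polynomial.C ((l.m - m) * (l.m - n)) * Polynomial.X := by
  simp [restr, planeEq]
  ring

theorem on_planeEq {m n c : K} {l : NullLine K} :
    l.On (planeEq m n c) ↔ (l.m = m ∨ l.m = n) ∧ l.γ - (m + n) * l.β = c := by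
  rw [On, restr_planeEq]
  constructor
  · intro h
    have e0 := congrArg (fun u => Polynomial.coeff u 0) h
    have e1 := congrArg (fun u => Polynomial.coeff u 1) h
    simp [sub_eq_zero] at e0 e1
    exact ⟨e1, e0⟩
  · rintro ⟨h1, h2⟩
    have : (l.m - m) * (l.m - n) = 0 := by simpa [sub_eq_zero] using h1
    rw [this, h2]
    simp

theorem eval_planeEq (m n c : K) (y : Fin 3 → K) :
    eval y (planeEq m n c) = y 0 - (m + n) * y 2 + m * n * y 1 - c := by
  simp [planeEq]

theorem meets_of_on_planeEq {c : K} {l l' : NullLine K} (hm : l.m ≠ l'.m)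
    (h : l.γ - (l.m + l'.m) * l.β = c) (h' : l'.γ - (l.m + l'.m) * l'.β = c) : l.Meets l' :=
  ⟨hm, by linear_combination h - h'⟩

theorem dir_dir_eq_zero {P : MvPolynomial (Fin 3) K} (h2 : P.totalDegree ≤ 2) {r : NullLine K}
    (hr : r.On P) : dir r.m (dir r.m P) = 0 := by
  have h := (totalDegree_dir_le r.m (dir r.m P)).trans
    (Nat.sub_le_sub_right (totalDegree_dir_le r.m P) 1)
  have h0 : (dir r.m (dir r.m P)).totalDegree = 0 := by omega
  rw [totalDegree_eq_zero_iff_eq_C] at h0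
  have e := hr.dir.dir.eval_eq_zero 0
  rw [h0, eval_C] at e
  rw [h0, e, C_0]

theorem eq_zero_of_two_roots {f : Polynomial K} (h1 : f.natDegree ≤ 1) {s t : K} (hst : s ≠ t)
    (hs : f.eval s = 0) (ht : f.eval t = 0) : f = 0 := by
  classical
  by_contra hf
  have := Polynomial.card_le_degree_of_subset_roots (p := f) (Z := {s, t}) (by
    intro u hu
    simp only [Finset.mem_val, Finset.mem_insert, Finset.mem_singleton] at hu
    rw [Polynomial.mem_roots hf]
    rcases hu with rfl | rfl
    · exact hs
    · exact ht)
  rw [Finset.card_pair hst] at this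
  omega

theorem natDegree_le_one_of_derivative (p : ℕ) [CharP K p] {f : Polynomial K}
    (h2 : f.natDegree ≤ 2) (hp : f.natDegree < p) (h : f.derivative.derivative = 0) :
    f.natDegree ≤ 1 := by
  by_contra hcon
  have hdeg : f.natDegree = 2 := by omega
  have e := congrArg (fun u => Polynomial.coeff u 0) h
  simp only [Polynomial.coeff_derivative, Polynomial.coeff_zero] at e
  have hlead : f.coeff 2 ≠ 0 := by
    rw [← hdeg]
    exact Polynomial.leadingCoeff_ne_zero.2 (fun h0 => by simp [h0] at hdeg)
  norm_num at e
  rcases e with e | e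
  · exact hlead e
  · have h2 : ((2 : ℕ) : K) = 0 := by
      rw [← e]
      norm_num
    rw [CharP.cast_eq_zero_iff K p] at h2
    have := Nat.le_of_dvd two_pos h2
    omega

/-- A quadric containing two crossing null lines and a further point of their plane contains the
plane. -/
theorem dvd_planeEq [Infinite K] (p : ℕ) [CharP K p] {P : MvPolynomial (Fin 3) K}
    (hP : Irreducible P) (h2 : P.totalDegree ≤ 2) (hp : P.totalDegree < p) {r b : NullLine K}
    (hr : r.On P) (hb : b.On P) (hm : r.Meets b) {y : Fin 3 → K} (hy : eval y P = 0)
    (hpl : eval y (planeEq b.m r.m (b.γ - (b.m + r.m) * b.β)) = 0) (hyr : ∀ s, r.pt s ≠ y)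
    (hyb : ∀ s, b.pt s ≠ y) : P ∣ planeEq b.m r.m (b.γ - (b.m + r.m) * b.β) := by
  obtain ⟨s₀, hs₀⟩ := hm.pt_eq
  have hdd := dir_dir_eq_zero h2 hr
  have hrestr : ∀ l : NullLine K, l.m = r.m →
      Polynomial.derivative (Polynomial.derivative (restr l P)) = 0 := by
    intro l hl
    rw [derivative_restr, derivative_restr, hl, hdd, map_zero]
  rw [eval_planeEq] at hpl
  obtain ⟨g, hg⟩ : ∃ g, g = through y r.m := ⟨_, rfl⟩
  have hgm : g.m = r.m := by rw [hg]; rfl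
  have hgb : g.Meets b := by
    refine meets_of_on_planeEq (c := b.γ - (b.m + r.m) * b.β) (by rw [hgm]; exact hm.1) ?_ ?_
    · rw [hg]
      simp only [through]
      linear_combination hpl
    · rw [hgm]
      ring
  have hgy : g.pt (y 1) = y := by rw [hg]; exact pt_through y r.m
  obtain ⟨u, hu⟩ := hgb.pt_eq
  have hu1 : u ≠ y 1 := by
    rintro rfl
    exact hyb _ (hu ▸ hgy)
  have hu2 : s₀ ≠ u := by
    rintro rfl
    have hgr : g = r := eq_of_pt_eq hgm (hu.trans hs₀.symm)
    exact hyr _ (hgr ▸ hgy)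
  have hgP : g.On P := by
    refine eq_zero_of_two_roots (natDegree_le_one_of_derivative p
      ((natDegree_restr_le g P).trans h2) ((natDegree_restr_le g P).trans_lt hp)
      (hrestr g hgm)) hu1 ?_ ?_
    · rw [eval_restr, hu]
      exact hb.eval_eq_zero u
    · rw [eval_restr, hgy, hy]
  have hVb : b.On (NullLine.dir r.m P) := by
    refine eq_zero_of_two_roots ((natDegree_restr_le _ _).trans
      ((totalDegree_dir_le _ _).trans (by omega))) hu2 ?_ ?_
    · rw [eval_restr, ← hs₀]
      exact hr.dir.eval_eq_zero s₀
    · rw [eval_restr, ← hu, ← hgm]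
      exact hgP.dir.eval_eq_zero u
  apply dvd_of_infinite hP
  have hinj : Function.Injective (fun t => through (b.pt t) r.m) := by
    intro t t' h
    by_contra hne
    have hβ : b.β + b.m * t - r.m * t = b.β + b.m * t' - r.m * t' := congrArg NullLine.β h
    have : (b.m - r.m) * (t - t') = 0 := by linear_combination hβ
    rcases mul_eq_zero.1 this with h3 | h3
    · exact hm.1 (sub_eq_zero.1 h3).symm
    · exact hne (sub_eq_zero.1 h3)
  refine (Set.infinite_range_of_injective hinj).mono ?_
  rintro _ ⟨t, rfl⟩
  have hpt : (through (b.pt t) r.m).pt t = b.pt t := pt_through (b.pt t) r.m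
  constructor
  · refine eq_zero_of_ode p (A := 0) (B := 0) (q := 1) (s := t)
      ((natDegree_restr_le _ P).trans_lt hp) ?_ ?_ (by simp) ?_
    · rw [eval_restr, hpt]
      exact hb.eval_eq_zero t
    · rw [derivative_restr, eval_restr, hpt]
      exact hVb.eval_eq_zero t
    · rw [hrestr (through (b.pt t) r.m) rfl]
      ring
  · rw [on_planeEq]
    refine ⟨Or.inr rfl, ?_⟩
    simp only [through, pt]
    simp
    ring

/-- Incidences between null lines contained in an irreducible surface of degree at most two. -/
theorem card_incidences_quadric_le [Infinite K] [DecidableEq K] (p : ℕ) [CharP K p]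
    {P : MvPolynomial (Fin 3) K} (hP : Irreducible P) (h2 : P.totalDegree ≤ 2)
    (hp : P.totalDegree < p) (R B : Finset (NullLine K)) (k : ℕ) (hR : ∀ r ∈ R, r.On P)
    (hB : ∀ b ∈ B, b.On P) (hRB : ∀ r ∈ R, ∀ b ∈ B, r.m ≠ b.m)
    (hBB : ∀ b ∈ B, ∀ b' ∈ B, ¬ b.Meets b')
    (hk : ∀ b ∈ B, ∀ b' ∈ B, b ≠ b' → ∀ S ⊆ R, (∀ r ∈ S, r.Meets b ∧ r.Meets b') → S.card ≤ k)
    (I : Finset (NullLine K × NullLine K)) (hI : ∀ t ∈ I, t.1 ∈ R ∧ t.2 ∈ B ∧ t.1.Meets t.2) :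
    I.card ≤ k * B.card + R.card := by
  classical
  by_cases hall : ∀ b ∈ B, (R.filter fun r => r.Meets b).card ≤ k
  · have : I.card ≤ k * B.card := by
      refine Finset.card_le_mul_card_image_of_maps_to (f := Prod.snd) (t := B)
        (fun t ht => (hI t ht).2.1) k ?_
      intro b hb
      refine le_trans ?_ (hall b hb)
      refine Finset.card_le_card_of_injOn Prod.fst ?_ ?_
      · intro t ht
        rw [Finset.mem_coe, Finset.mem_filter] at ht
        have := hI t ht.1
        rw [ht.2] at this
        simp [this]
      · rintro ⟨a, b⟩ ht ⟨a', b'⟩ ht' h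
        simp_all
    omega
  push Not at hall
  obtain ⟨b₀, hb₀, hdeg⟩ := hall
  have hcontra : ∀ b ∈ B, b ≠ b₀ → ¬ ∀ r ∈ R, r.Meets b₀ → r.Meets b := by
    intro b hb hne h
    refine absurd (hk b hb b₀ hb₀ hne (R.filter fun r => r.Meets b₀) (Finset.filter_subset _ _) ?_)
      (not_le.2 hdeg)
    intro r hr
    rw [Finset.mem_filter] at hr
    exact ⟨h r hr.1 hr.2, hr.2⟩
  have hslope : ∀ b ∈ B, b.m = b₀.m := by
    intro b hb
    by_contra hne
    refine hcontra b hb (fun h => hne (by rw [h])) ?_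
    intro r hr hrb₀
    have hnr : b.m - r.m ≠ 0 := sub_ne_zero.2 (hRB r hr b hb).symm
    have hn0 : b.m - b₀.m ≠ 0 := sub_ne_zero.2 hne
    obtain ⟨c, hc⟩ : ∃ c, c = b₀.γ - (b₀.m + r.m) * b₀.β := ⟨_, rfl⟩
    obtain ⟨s, hs⟩ : ∃ s, eval (b.pt s) (planeEq b₀.m r.m c) = 0 := by
      refine ⟨-(b.γ - (b₀.m + r.m) * b.β - c) / ((b.m - b₀.m) * (b.m - r.m)), ?_⟩
      rw [← eval_restr, restr_planeEq]
      simp only [Polynomial.eval_add, Polynomial.eval_mul, Polynomial.eval_C, Polynomial.eval_X]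
      field_simp
      ring
    by_contra hnot
    have hdvd := dvd_planeEq p hP h2 hp (hR r hr) (hB b₀ hb₀) hrb₀
      ((hB b hb).eval_eq_zero s) (hc ▸ hs)
      (fun t ht => hnot (meets_of_pt_eq (hRB r hr b hb) ht))
      (fun t ht => hBB b₀ hb₀ b hb (meets_of_pt_eq (Ne.symm hne) ht))
    rcases (on_planeEq.1 ((hB b hb).of_dvd hdvd)).1 with h | h
    · exact hne h
    · exact hRB r hr b hb h.symm
  have huniq : ∀ r ∈ R, ∀ b ∈ B, ∀ b' ∈ B, r.Meets b → r.Meets b' → b = b' := by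
    intro r hr b hb b' hb' h h'
    by_contra hne
    have hbm : b'.m = b.m := (hslope b' hb').trans (hslope b hb).symm
    obtain ⟨s, hs⟩ := h'.pt_eq
    have hpl : ∀ t, eval (b'.pt t) (planeEq b.m r.m (b.γ - (b.m + r.m) * b.β)) = 0 := by
      intro t
      apply On.eval_eq_zero
      rw [on_planeEq]
      refine ⟨Or.inl hbm, ?_⟩
      have e := h.2
      have e' := h'.2
      rw [hbm] at e'
      linear_combination e - e'
    have hdvd := dvd_planeEq p hP h2 hp (hR r hr) (hB b hb) h
      ((hB b' hb').eval_eq_zero (s + 1)) (hpl (s + 1)) (by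
        intro t ht
        have h1 : t = s + 1 := congrFun ht 1
        have e1 : r.β + r.m * t = b'.β + b'.m * (s + 1) := congrFun ht 2
        have e2 : r.β + r.m * s = b'.β + b'.m * s := congrFun hs 2
        rw [h1] at e1
        exact hRB r hr b' hb' (by linear_combination e1 - e2))
      (fun t ht => hne (eq_of_pt_eq hbm.symm ht))
    obtain ⟨b₁, hb₁, hb₁0, hb₁m⟩ : ∃ b₁ ∈ B, b₁ ≠ b₀ ∧ b₁.m = b.m := by
      by_cases hbb : b = b₀
      · exact ⟨b', hb', fun h => hne (hbb.trans h.symm), hbm⟩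
      · exact ⟨b, hb, hbb, rfl⟩
    refine hcontra b₁ hb₁ hb₁0 ?_
    intro r' hr' _
    have k1 := on_planeEq.1 ((hR r' hr').of_dvd hdvd)
    have k2 := on_planeEq.1 ((hB b₁ hb₁).of_dvd hdvd)
    have hr'm : r'.m = r.m := k1.1.resolve_left (hRB r' hr' b hb)
    refine meets_of_on_planeEq (hRB r' hr' b₁ hb₁) (c := b.γ - (b.m + r.m) * b.β) ?_ ?_
    · rw [hr'm, hb₁m, add_comm]
      exact k1.2
    · rw [hr'm, hb₁m, add_comm]
      exact k2.2
  have : I.card ≤ R.card := by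
    refine Finset.card_le_card_of_injOn Prod.fst (fun t ht => (hI t ht).1) ?_
    rintro ⟨a, b⟩ ht ⟨a', b'⟩ ht' h
    have h1 := hI _ ht
    have h2 := hI _ ht'
    simp only at h h1 h2
    subst h
    rw [huniq a h1.1 b h1.2.1 b' h2.2.1 h1.2.2 h2.2.2]
  omega

end NullLine

namespace NullLine

open MvPolynomial

variable {K : Type*} [Field K]

open Classical in
/-- The lines of `B` meeting `r`. -/
noncomputable def neighbors (B : Finset (NullLine K)) (r : NullLine K) : Finset (NullLine K) :=
  B.filter fun b => r.Meets b

/-- The number of incidences between two families of lines. -/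
noncomputable def inc (R B : Finset (NullLine K)) : ℕ := ∑ r ∈ R, (neighbors B r).card

theorem mem_neighbors {B : Finset (NullLine K)} {r b : NullLine K} :
    b ∈ neighbors B r ↔ b ∈ B ∧ r.Meets b := by
  simp [neighbors]

theorem neighbors_subset (B : Finset (NullLine K)) (r : NullLine K) : neighbors B r ⊆ B :=
  fun _ h => (mem_neighbors.1 h).1

open Classical in
theorem inc_eq_card (R B : Finset (NullLine K)) :
    inc R B = ((R ×ˢ B).filter fun t => t.1.Meets t.2).card := by
  simp only [inc, neighbors, Finset.card_filter, Finset.sum_product]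

theorem inc_comm (R B : Finset (NullLine K)) : inc R B = inc B R := by
  classical
  simp only [inc, neighbors, Finset.card_filter]
  rw [Finset.sum_comm]
  refine Finset.sum_congr rfl fun b _ => Finset.sum_congr rfl fun r _ => ?_
  congr 1
  exact propext ⟨Meets.symm, Meets.symm⟩

theorem neighbors_mono {B B' : Finset (NullLine K)} (h : B ⊆ B') (r : NullLine K) :
    neighbors B r ⊆ neighbors B' r := fun _ hb =>
  mem_neighbors.2 ⟨h (mem_neighbors.1 hb).1, (mem_neighbors.1 hb).2⟩

theorem inc_mono {R R' B B' : Finset (NullLine K)} (hR : R ⊆ R') (hB : B ⊆ B') :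
    inc R B ≤ inc R' B' :=
  (Finset.sum_le_sum_of_subset hR).trans
    (Finset.sum_le_sum fun r _ => Finset.card_le_card (neighbors_mono hB r))

theorem inc_le_mul {R B : Finset (NullLine K)} {d : ℕ} (h : ∀ r ∈ R, (neighbors B r).card ≤ d) :
    inc R B ≤ d * R.card := by
  rw [mul_comm, ← smul_eq_mul]
  exact Finset.sum_le_card_nsmul _ _ _ h

open Classical in
theorem inc_filter_left (R B : Finset (NullLine K)) (q : NullLine K → Prop) :
    inc R B = inc (R.filter q) B + inc (R.filter fun r => ¬ q r) B :=
  (Finset.sum_filter_add_sum_filter_not R q _).symm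

open Classical in
theorem inc_filter_right (R B : Finset (NullLine K)) (q : NullLine K → Prop) :
    inc R B = inc R (B.filter q) + inc R (B.filter fun b => ¬ q b) := by
  rw [inc_comm R B, inc_filter_left B R q, inc_comm (B.filter q) R, inc_comm _ R]

open Classical in
theorem inc_add_le_inc_union {R₁ R₂ B₁ B₂ : Finset (NullLine K)} (h : Disjoint B₁ B₂) :
    inc R₁ B₁ + inc R₂ B₂ ≤ inc (R₁ ∪ R₂) (B₁ ∪ B₂) := by
  have hu : inc (B₁ ∪ B₂) (R₁ ∪ R₂) = inc B₁ (R₁ ∪ R₂) + inc B₂ (R₁ ∪ R₂) := Finset.sum_union h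
  rw [inc_comm (R₁ ∪ R₂), hu, inc_comm R₁, inc_comm R₂]
  exact Nat.add_le_add (inc_mono subset_rfl Finset.subset_union_left)
    (inc_mono subset_rfl Finset.subset_union_right)

/-- Two families of null lines of different slopes such that no two lines of the same family meet
and any two distinct lines of the second have at most `k` common neighbors. -/
structure Config (R B : Finset (NullLine K)) (k : ℕ) : Prop where
  slope_ne : ∀ r ∈ R, ∀ b ∈ B, r.m ≠ b.m
  not_meets_left : ∀ r ∈ R, ∀ r' ∈ R, ¬ r.Meets r'
  not_meets_right : ∀ b ∈ B, ∀ b' ∈ B, ¬ b.Meets b'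
  card_common : ∀ b ∈ B, ∀ b' ∈ B, b ≠ b' → ∀ S ⊆ R, (∀ r ∈ S, r.Meets b ∧ r.Meets b') →
    S.card ≤ k

theorem Config.mono {R B R' B' : Finset (NullLine K)} {k : ℕ} (h : Config R B k) (hR : R' ⊆ R)
    (hB : B' ⊆ B) : Config R' B' k where
  slope_ne r hr b hb := h.slope_ne r (hR hr) b (hB hb)
  not_meets_left r hr r' hr' := h.not_meets_left r (hR hr) r' (hR hr')
  not_meets_right b hb b' hb' := h.not_meets_right b (hB hb) b' (hB hb')
  card_common b hb b' hb' hne S hS := h.card_common b (hB hb) b' (hB hb') hne S (hS.trans hR)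

/-- Pairwise non-meeting lines crossing a line outside `T = 0` at points of `T = 0`. -/
theorem card_crossing_le {T : MvPolynomial (Fin 3) K} {r : NullLine K} (hr : ¬ r.On T)
    (S : Finset (NullLine K)) (hS : ∀ b ∈ S, ∀ b' ∈ S, ¬ b.Meets b')
    (h : ∀ b ∈ S, ∃ s, r.pt s = b.pt s ∧ eval (r.pt s) T = 0) : S.card ≤ T.totalDegree := by
  classical
  choose! f hf using h
  have hinj : Set.InjOn f S := by
    intro b hb b' hb' hbb'
    have h1 := (hf b hb).1
    have h2 := (hf b' hb').1
    rw [← hbb'] at h2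
    have h3 : b.pt (f b) = b'.pt (f b) := h1.symm.trans h2
    by_cases hm : b.m = b'.m
    · exact eq_of_pt_eq hm h3
    · exact absurd (meets_of_pt_eq hm h3) (hS b hb b' hb')
  rw [← Finset.card_image_of_injOn hinj]
  refine card_le_of_not_on hr _ ?_
  intro s hs
  obtain ⟨b, hb, rfl⟩ := Finset.mem_image.1 hs
  exact (hf b hb).2

theorem card_neighbors_le_of_not_on {T : MvPolynomial (Fin 3) K} {r : NullLine K} (hr : ¬ r.On T)
    (S : Finset (NullLine K)) (hS : ∀ b ∈ S, ∀ b' ∈ S, ¬ b.Meets b') (hT : ∀ b ∈ S, b.On T) :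
    (neighbors S r).card ≤ T.totalDegree := by
  apply card_crossing_le hr
  · exact fun b hb b' hb' => hS b (neighbors_subset _ _ hb) b' (neighbors_subset _ _ hb')
  · intro b hb
    obtain ⟨hb, hm⟩ := mem_neighbors.1 hb
    obtain ⟨s, hs⟩ := hm.pt_eq
    exact ⟨s, hs, hs ▸ (hT b hb).eval_eq_zero s⟩

variable [Infinite K]

theorem Config.exists_exceptional_of_irreducible (p : ℕ) [CharP K p] {Q : MvPolynomial (Fin 3) K}
    (hQ : Irreducible Q) (hp : Q.totalDegree < p) {R B : Finset (NullLine K)} {k : ℕ}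
    (h : Config R B k) (hB : ∀ b ∈ B, b.On Q) :
    ∃ R' ⊆ R, ∃ B' ⊆ B, R'.card ≤ 25 * Q.totalDegree ^ 2 ∧ B'.card ≤ 25 * Q.totalDegree ^ 2 ∧
      inc R B ≤ 5 * Q.totalDegree * R.card + 4 * Q.totalDegree * B.card + k * B.card +
        inc R' B' := by
  classical
  have hd := totalDegree_pos_of_irreducible hQ
  set d := Q.totalDegree with hdef
  set R₁ := R.filter fun r => r.On Q with hR₁
  have hR₁R : R₁ ⊆ R := Finset.filter_subset _ _
  have hsplit := inc_filter_left R B (fun r => r.On Q)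
  have hnot : inc (R.filter fun r => ¬ r.On Q) B ≤ d * R.card := by
    refine (inc_le_mul (d := d) ?_).trans
      (Nat.mul_le_mul_left _ (Finset.card_le_card (Finset.filter_subset _ _)))
    intro r hr
    exact card_neighbors_le_of_not_on (Finset.mem_filter.1 hr).2 B h.not_meets_right hB
  rcases le_or_gt d 2 with h2 | h2
  · refine ⟨∅, Finset.empty_subset _, ∅, Finset.empty_subset _, by simp, by simp, ?_⟩
    have hquad : inc R₁ B ≤ k * B.card + R₁.card := by
      rw [inc_eq_card]
      have h' := h.mono hR₁R subset_rfl
      refine card_incidences_quadric_le p hQ h2 hp R₁ B k (fun r hr => (Finset.mem_filter.1 hr).2)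
        hB h'.slope_ne h'.not_meets_right h'.card_common _ ?_
      intro t ht
      rw [Finset.mem_filter, Finset.mem_product] at ht
      exact ⟨ht.1.1, ht.1.2, ht.2⟩
    have hc := Finset.card_le_card hR₁R
    have : R.card ≤ d * R.card := Nat.le_mul_of_pos_left _ hd
    have e : 5 * d * R.card = 5 * (d * R.card) := by ring
    rw [← hR₁] at hsplit
    have := Nat.zero_le (4 * d * B.card)
    omega
  · obtain ⟨T, hT, hTd, hcross⟩ := exists_crossing_polynomial p hQ hp h2
    rw [← hdef] at hTd
    set R₂ := R₁.filter fun r => r.On T with hR₂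
    set B₂ := B.filter fun b => b.On T with hB₂
    have hbound : ∀ L : Finset (NullLine K), (∀ l ∈ L, l.On Q) → (∀ l ∈ L, l.On T) →
        L.card ≤ 25 * d ^ 2 := by
      intro L h1 h2
      refine (card_le_of_on_of_on hQ hT L h1 h2).trans ?_
      refine (Nat.pow_le_pow_left (Nat.add_le_add_left hTd _) 2).trans (le_of_eq ?_)
      rw [← hdef]
      ring
    refine ⟨R₂, (Finset.filter_subset _ _).trans hR₁R, B₂, Finset.filter_subset _ _, ?_, ?_, ?_⟩
    · exact hbound _ (fun l hl => (Finset.mem_filter.1 (Finset.mem_filter.1 hl).1).2)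
        (fun l hl => (Finset.mem_filter.1 hl).2)
    · exact hbound _ (fun l hl => hB l (Finset.mem_filter.1 hl).1)
        (fun l hl => (Finset.mem_filter.1 hl).2)
    have hcr : ∀ r ∈ R₁, ∀ b ∈ B, r.Meets b → ∃ s, r.pt s = b.pt s ∧ eval (r.pt s) T = 0 := by
      intro r hr b hb hm
      obtain ⟨s, hs⟩ := hm.pt_eq
      exact ⟨s, hs, hcross r b (Finset.mem_filter.1 hr).2 (hB b hb) hm.1 s hs⟩
    have hs1 := inc_filter_left R₁ B (fun r => r.On T)
    have hs2 := inc_filter_right R₂ B (fun b => b.On T)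
    have hn1 : inc (R₁.filter fun r => ¬ r.On T) B ≤ 4 * d * R.card := by
      refine (inc_le_mul (d := 4 * d) ?_).trans
        (Nat.mul_le_mul_left _ (Finset.card_le_card ((Finset.filter_subset _ _).trans hR₁R)))
      intro r hr
      rw [Finset.mem_filter] at hr
      refine (card_crossing_le hr.2 (neighbors B r) ?_ ?_).trans hTd
      · exact fun b hb b' hb' => h.not_meets_right b (neighbors_subset _ _ hb) b'
          (neighbors_subset _ _ hb')
      · exact fun b hb => hcr r hr.1 b (mem_neighbors.1 hb).1 (mem_neighbors.1 hb).2
    have hn2 : inc R₂ (B.filter fun b => ¬ b.On T) ≤ 4 * d * B.card := by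
      rw [inc_comm]
      refine (inc_le_mul (d := 4 * d) ?_).trans
        (Nat.mul_le_mul_left _ (Finset.card_le_card (Finset.filter_subset _ _)))
      intro b hb
      rw [Finset.mem_filter] at hb
      refine (card_crossing_le hb.2 (neighbors R₂ b) ?_ ?_).trans hTd
      · have hsub : neighbors R₂ b ⊆ R :=
          (neighbors_subset _ _).trans ((Finset.filter_subset _ _).trans hR₁R)
        exact fun r hr r' hr' => h.not_meets_left r (hsub hr) r' (hsub hr')
      · intro r hr
        rw [mem_neighbors] at hr
        obtain ⟨s, hs, he⟩ := hcr r (Finset.filter_subset _ _ hr.1) b hb.1 hr.2.symm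
        exact ⟨s, hs.symm, hs ▸ he⟩
    have e : 5 * d * R.card = d * R.card + 4 * d * R.card := by ring
    rw [← hR₁] at hsplit
    rw [← hR₂] at hs1
    rw [← hB₂] at hs2
    have := Nat.zero_le (k * B.card)
    omega

/-- Incidences with lines on a surface of degree `d` are controlled up to `O(d²)` lines. -/
theorem Config.exists_exceptional (p : ℕ) [CharP K p] {R : Finset (NullLine K)} {k : ℕ}
    (P : MvPolynomial (Fin 3) K) (hP : P ≠ 0) (hp : P.totalDegree < p) (B : Finset (NullLine K))
    (h : Config R B k) (hB : ∀ b ∈ B, b.On P) :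
    ∃ R' ⊆ R, ∃ B' ⊆ B, R'.card ≤ 25 * P.totalDegree ^ 2 ∧ B'.card ≤ 25 * P.totalDegree ^ 2 ∧
      inc R B ≤ 5 * P.totalDegree * R.card + 4 * P.totalDegree * B.card + k * B.card +
        inc R' B' := by
  classical
  induction P using WfDvdMonoid.induction_on_irreducible generalizing B with
  | zero => exact absurd rfl hP
  | unit u hu =>
    have hemp : B = ∅ := by
      rw [Finset.eq_empty_iff_forall_notMem]
      intro b hb
      have h0 := hB b hb
      rw [On] at h0
      exact (hu.map (restr b)).ne_zero h0
    subst hemp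
    exact ⟨∅, Finset.empty_subset _, ∅, subset_rfl, by simp, by simp, by simp [inc, neighbors]⟩
  | mul P Q hP0 hQ ih =>
    have hdeg : (Q * P).totalDegree = Q.totalDegree + P.totalDegree :=
      totalDegree_mul_of_isDomain hQ.ne_zero hP0
    rw [hdeg] at hp ⊢
    set B₁ := B.filter fun b => b.On Q with hB₁
    set B₂ := B.filter fun b => ¬ b.On Q with hB₂
    have hB₁B : B₁ ⊆ B := Finset.filter_subset _ _
    have hB₂B : B₂ ⊆ B := Finset.filter_subset _ _
    obtain ⟨R', hR', B', hB', c1, c2, c3⟩ :=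
      (h.mono subset_rfl hB₁B).exists_exceptional_of_irreducible p hQ (by omega)
        (fun b hb => (Finset.mem_filter.1 hb).2)
    obtain ⟨R'', hR'', B'', hB'', c4, c5, c6⟩ := ih hP0 (by omega) B₂ (h.mono subset_rfl hB₂B)
      (fun b hb => (on_mul.1 (hB b (hB₂B hb))).resolve_left (Finset.mem_filter.1 hb).2)
    have hdisj : Disjoint B' B'' := by
      rw [Finset.disjoint_left]
      intro b hb hb'
      exact (Finset.mem_filter.1 (hB'' hb')).2 (Finset.mem_filter.1 (hB' hb)).2
    refine ⟨R' ∪ R'', Finset.union_subset hR' hR'', B' ∪ B'',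
      Finset.union_subset (hB'.trans hB₁B) (hB''.trans hB₂B), ?_, ?_, ?_⟩
    · refine (Finset.card_union_le _ _).trans ?_
      nlinarith [Nat.zero_le (Q.totalDegree * P.totalDegree)]
    · refine (Finset.card_union_le _ _).trans ?_
      nlinarith [Nat.zero_le (Q.totalDegree * P.totalDegree)]
    · have hs := inc_filter_right R B (fun b => b.On Q)
      rw [← hB₁, ← hB₂] at hs
      have hu := inc_add_le_inc_union (R₁ := R') (R₂ := R'') hdisj
      have hc : B.card = B₁.card + B₂.card :=
        (Finset.card_filter_add_card_filter_not (s := B) fun b => b.On Q).symm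
      rw [hc, hs]
      have e1 : 4 * Q.totalDegree * B₁.card + 4 * P.totalDegree * B₂.card ≤
          4 * (Q.totalDegree + P.totalDegree) * (B₁.card + B₂.card) := by
        nlinarith [Nat.zero_le (Q.totalDegree * B₂.card), Nat.zero_le (P.totalDegree * B₁.card)]
      have e2 : 5 * (Q.totalDegree + P.totalDegree) * R.card =
        5 * Q.totalDegree * R.card + 5 * P.totalDegree * R.card := by ring
      have e3 : k * (B₁.card + B₂.card) = k * B₁.card + k * B₂.card := by ring
      omega

end NullLine

namespace NullLine

open MvPolynomial

variable {K : Type*} [Field K]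

/-- Fewer than `(e + 1)³ / (3 * e + 1)` lines lie on a surface of degree at most `3 * e`. -/
theorem exists_on_of_card_lt [Infinite K] (R : Finset (NullLine K)) (e : ℕ)
    (h : (3 * e + 1) * R.card < (e + 1) ^ 3) :
    ∃ P : MvPolynomial (Fin 3) K, P ≠ 0 ∧ P.totalDegree ≤ 3 * e ∧ ∀ r ∈ R, r.On P := by
  classical
  let v : (Fin 3 → Fin (e + 1)) → (Fin 3 →₀ ℕ) := fun a =>
    Finsupp.equivFunOnFinite.symm fun i => (a i : ℕ)
  have hv : Function.Injective v := by
    intro a b hab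
    funext i
    have := DFunLike.congr_fun hab i
    exact Fin.ext (by simpa [v] using this)
  let poly : ((Fin 3 → Fin (e + 1)) → K) →ₗ[K] MvPolynomial (Fin 3) K :=
    ∑ a, (monomial (v a)).comp (LinearMap.proj a)
  have hpoly : ∀ f, poly f = ∑ a, monomial (v a) (f a) := by
    intro f
    simp [poly, LinearMap.sum_apply]
  let x : Fin (3 * e + 1) → K := fun j => Infinite.natEmbedding K j
  have hx : Function.Injective x := fun i j hij =>
    Fin.ext ((Infinite.natEmbedding K).injective hij)
  let ev : ((Fin 3 → Fin (e + 1)) → K) →ₗ[K] (R × Fin (3 * e + 1) → K) :=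
    LinearMap.pi fun t => (aeval (t.1.1.pt (x t.2))).toLinearMap.comp poly
  have hker : LinearMap.ker ev ≠ ⊥ := by
    apply LinearMap.ker_ne_bot_of_finrank_lt
    simp only [Module.finrank_fintype_fun_eq_card, Fintype.card_prod, Fintype.card_coe,
      Fintype.card_fin, Fintype.card_fun]
    rw [mul_comm]
    exact h
  obtain ⟨f, hf, hf0⟩ := (Submodule.ne_bot_iff _).1 hker
  have hdeg : (poly f).totalDegree ≤ 3 * e := by
    rw [hpoly]
    refine totalDegree_finsetSum_le fun a _ => (totalDegree_monomial_le _ _).trans ?_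
    rw [Finsupp.sum_fintype _ _ (by simp), Fin.sum_univ_three]
    have h0 := (a 0).is_le
    have h1 := (a 1).is_le
    have h2 := (a 2).is_le
    simp only [v, Finsupp.equivFunOnFinite_symm_apply_apply, id]
    omega
  refine ⟨poly f, ?_, hdeg, ?_⟩
  · intro h0
    apply hf0
    funext a
    have := congrArg (coeff (v a)) h0
    rw [hpoly, coeff_sum] at this
    simpa [coeff_monomial, hv.eq_iff] using this
  · intro r hr
    by_contra hon
    have := card_le_of_not_on hon (Finset.univ.image x) (by
      intro s hs
      obtain ⟨j, -, rfl⟩ := Finset.mem_image.1 hs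
      have := congrFun (LinearMap.mem_ker.1 hf) (⟨r, hr⟩, j)
      simpa [ev, aeval_eq_eval] using this)
    rw [Finset.card_image_of_injective _ hx, Finset.card_univ, Fintype.card_fin] at this
    omega

end NullLine

open Finset in
theorem sum_comp_eval_mul_eq_zero {ι : Type*} [Fintype ι] [DecidableEq ι] {s : ℕ} [NeZero s]
    (g : ZMod s → ℤ) (hg : ∑ c, g c = 0) {r r' : ι} (h : r ≠ r') :
    ∑ f : ι → ZMod s, g (f r) * g (f r') = 0 := by
  have h1 : ∀ c : ZMod s, ∑ f : ι → ZMod s, g (f r + c) * g (f r') =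
      ∑ f : ι → ZMod s, g (f r) * g (f r') := by
    intro c
    refine Fintype.sum_equiv (Equiv.addRight (Pi.single r c)) _ _ fun f => ?_
    simp [Pi.single_eq_of_ne h.symm]
  have h2 : ∑ c : ZMod s, ∑ f : ι → ZMod s, g (f r + c) * g (f r') = 0 := by
    rw [sum_comm]
    refine sum_eq_zero fun f _ => ?_
    rw [← sum_mul, Fintype.sum_equiv (Equiv.addLeft (f r)) (fun c => g (f r + c)) g fun _ => rfl,
      hg, zero_mul]
  simp only [h1, sum_const, card_univ, ZMod.card, nsmul_eq_mul] at h2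
  exact (mul_eq_zero.1 h2).resolve_left (by exact_mod_cast NeZero.ne s)

open Finset in
theorem mul_sum_comp_eval {ι : Type*} [Fintype ι] [DecidableEq ι] {s : ℕ} [NeZero s]
    (g : ZMod s → ℤ) (r : ι) :
    s * ∑ f : ι → ZMod s, g (f r) = s ^ Fintype.card ι * ∑ c, g c := by
  have h1 : ∀ c : ZMod s, ∑ f : ι → ZMod s, g (f r + c) = ∑ f : ι → ZMod s, g (f r) := by
    intro c
    refine Fintype.sum_equiv (Equiv.addRight (Pi.single r c)) _ _ fun f => ?_
    simp
  have h2 : ∑ c : ZMod s, ∑ f : ι → ZMod s, g (f r + c) = s ^ Fintype.card ι * ∑ c, g c := by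
    rw [sum_comm]
    simp_rw [fun f : ι → ZMod s =>
      Fintype.sum_equiv (Equiv.addLeft (f r)) (fun c => g (f r + c)) g fun _ => rfl]
    simp
  simpa only [h1, sum_const, card_univ, ZMod.card, nsmul_eq_mul] using h2

open Finset in
/-- Second moment bound for the number of points of `T` in a random set of density `1 / s`. -/
theorem sum_sq_sample_le {ι : Type*} [Fintype ι] [DecidableEq ι] {s : ℕ} [NeZero s]
    (T : Finset ι) :
    ∑ f : ι → ZMod s, ((s * #{r ∈ T | f r = 0} : ℤ) - #T) ^ 2 ≤
      s * #T * s ^ Fintype.card ι := by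
  set g : ZMod s → ℤ := fun c => s * (if c = 0 then 1 else 0) - 1 with hg
  have hg0 : ∑ c, g c = 0 := by simp [hg, sum_sub_distrib]
  have hg2 : ∑ c, g c ^ 2 ≤ s * s := by
    have : ∀ c, g c ^ 2 = (s - 2) * (s * (if c = 0 then 1 else 0)) + 1 := by
      intro c
      simp only [hg]
      split_ifs <;> ring
    simp_rw [this]
    rw [sum_add_distrib, ← mul_sum, ← mul_sum]
    simp
    nlinarith
  have hX : ∀ f : ι → ZMod s, (s * #{r ∈ T | f r = 0} : ℤ) - #T = ∑ r ∈ T, g (f r) := by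
    intro f
    simp only [hg, sum_sub_distrib, ← mul_sum, card_filter]
    simp
  have hs : (0 : ℤ) < s := by exact_mod_cast NeZero.pos s
  have hself : ∀ r : ι, ∑ f : ι → ZMod s, g (f r) ^ 2 ≤ s * s ^ Fintype.card ι := by
    intro r
    have := mul_sum_comp_eval (fun c => g c ^ 2) r
    have h3 : (s : ℤ) ^ Fintype.card ι * ∑ c, g c ^ 2 ≤ s ^ Fintype.card ι * (s * s) := by gcongr
    refine le_of_mul_le_mul_left ?_ hs
    calc _ = _ := this
      _ ≤ _ := h3
      _ = _ := by ring
  simp_rw [hX, sq, sum_mul_sum]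
  rw [sum_comm]
  have : ∀ r ∈ T, ∑ f : ι → ZMod s, ∑ r' ∈ T, g (f r) * g (f r') ≤ s * s ^ Fintype.card ι := by
    intro r hr
    rw [sum_comm, sum_eq_single_of_mem r hr]
    · simpa only [sq] using hself r
    · intro r' _ hne
      exact sum_comp_eval_mul_eq_zero g hg0 hne.symm
  refine (sum_le_card_nsmul _ _ _ this).trans (le_of_eq ?_)
  simp
  ring

open Finset in
theorem exists_sample_fintype {ι β : Type*} [Fintype ι] [DecidableEq ι] (B : Finset β)
    (N : β → Finset ι) (s d n : ℕ) (hs : 0 < s) (hι : Fintype.card ι ≤ n) (hB : #B ≤ n) :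
    ∃ R' : Finset ι, s * #R' ≤ 2 * n ∧
      ∑ b ∈ B with #{r ∈ N b | r ∈ R'} ≤ d ∧ 2 * s * d ≤ #(N b), #(N b) ≤ 8 * s * n := by
  have : NeZero s := ⟨hs.ne'⟩
  set S : (ι → ZMod s) → Finset ι := fun f => {r | f r = 0} with hS
  have hmem : ∀ f r, r ∈ S f ↔ f r = 0 := by simp [hS]
  set W := s ^ Fintype.card ι
  have h1 : s * ∑ f, #(S f) ≤ n * W := by
    have : ∀ r : ι, s * ∑ f : ι → ZMod s, (if f r = 0 then 1 else 0) = W := by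
      intro r
      have := mul_sum_comp_eval (s := s) (fun c => if c = 0 then 1 else 0) r
      simp only [sum_ite_eq', mem_univ, if_true, mul_one] at this
      exact_mod_cast this
    simp only [hS, card_filter]
    rw [sum_comm, mul_sum]
    simp only [this, sum_const, smul_eq_mul, card_univ]
    gcongr
  have h2 : ∀ b, 2 * s * d ≤ #(N b) →
      #{f | #{r ∈ N b | r ∈ S f} ≤ d} * #(N b) ≤ 4 * s * W := by
    intro b hb
    rcases Nat.eq_zero_or_pos #(N b) with h0 | hpos
    · simp [h0]
    have h3 := sum_sq_sample_le (s := s) (N b)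
    have h4 : (#{f : ι → ZMod s | #{r ∈ N b | r ∈ S f} ≤ d} : ℤ) * #(N b) ^ 2 ≤
        4 * ∑ f : ι → ZMod s, ((s * #{r ∈ N b | f r = 0} : ℤ) - #(N b)) ^ 2 := by
      rw [mul_sum, ← nsmul_eq_mul]
      refine (card_nsmul_le_sum _
        (fun f => 4 * ((s * #{r ∈ N b | f r = 0} : ℤ) - #(N b)) ^ 2) _ ?_).trans ?_
      · intro f hf
        simp only [mem_filter, mem_univ, true_and, hmem] at hf
        have h5 : 2 * (s * #{r ∈ N b | f r = 0}) ≤ #(N b) := by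
          refine le_trans ?_ hb
          rw [mul_assoc]
          gcongr
        zify at h5
        nlinarith
      · exact sum_le_sum_of_subset_of_nonneg (filter_subset _ _) fun f _ _ => by positivity
    have h5 : (#{f : ι → ZMod s | #{r ∈ N b | r ∈ S f} ≤ d} : ℤ) * #(N b) * #(N b) ≤
        4 * s * W * #(N b) := by
      calc _ = (#{f : ι → ZMod s | #{r ∈ N b | r ∈ S f} ≤ d} : ℤ) * #(N b) ^ 2 := by ring
        _ ≤ _ := h4
        _ ≤ 4 * (s * #(N b) * s ^ Fintype.card ι) := by gcongr
        _ = _ := by simp only [W]; push_cast; ring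
    refine Nat.le_of_mul_le_mul_right ?_ hpos
    exact_mod_cast h5
  have h3 : ∑ f, ∑ b ∈ B with #{r ∈ N b | r ∈ S f} ≤ d ∧ 2 * s * d ≤ #(N b), #(N b) ≤
      n * (4 * s * W) := by
    simp only [sum_filter]
    rw [sum_comm]
    have : ∀ b ∈ B, ∑ f, (if #{r ∈ N b | r ∈ S f} ≤ d ∧ 2 * s * d ≤ #(N b) then #(N b) else 0) ≤
        4 * s * W := by
      intro b _
      by_cases hb : 2 * s * d ≤ #(N b)
      · simp only [hb, and_true, ← sum_filter, sum_const, smul_eq_mul]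
        exact h2 b hb
      · simp [hb]
    refine (sum_le_card_nsmul _ _ _ this).trans ?_
    rw [smul_eq_mul]
    gcongr
  have h4 : ∑ f : ι → ZMod s, (4 * s * (s * #(S f)) +
      ∑ b ∈ B with #{r ∈ N b | r ∈ S f} ≤ d ∧ 2 * s * d ≤ #(N b), #(N b)) ≤
      ∑ f : ι → ZMod s, 8 * s * n := by
    rw [sum_add_distrib, ← mul_sum, ← mul_sum]
    simp only [sum_const, card_univ, Fintype.card_fun, ZMod.card, smul_eq_mul]
    calc _ ≤ 4 * s * (n * W) + n * (4 * s * W) := by gcongr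
      _ = _ := by ring
  obtain ⟨f, -, hf⟩ := exists_le_of_sum_le univ_nonempty h4
  refine ⟨S f, ?_, by omega⟩
  have : 4 * s * (s * #(S f)) ≤ 4 * s * (2 * n) := by
    refine le_trans (Nat.le_add_right _ _) (hf.trans (le_of_eq (by ring)))
  exact Nat.le_of_mul_le_mul_left this (by positivity)

open Finset in
/-- Random sampling: a set `R'` of density `O(1 / s)` in `R` which meets most large sets of a
family in more than `d` points. -/
theorem exists_sample {α β : Type*} [DecidableEq α] (R : Finset α) (B : Finset β)
    (N : β → Finset α) (hN : ∀ b ∈ B, N b ⊆ R) (s d n : ℕ) (hs : 0 < s) (hR : #R ≤ n)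
    (hB : #B ≤ n) :
    ∃ R' ⊆ R, s * #R' ≤ 2 * n ∧
      ∑ b ∈ B with #{r ∈ N b | r ∈ R'} ≤ d ∧ 2 * s * d ≤ #(N b), #(N b) ≤ 8 * s * n := by
  have hcard : ∀ b ∈ B, #((N b).subtype (· ∈ R)) = #(N b) := by
    intro b hb
    rw [card_subtype, filter_true_of_mem fun r hr => hN b hb hr]
  obtain ⟨R', h1, h2⟩ := exists_sample_fintype (ι := R) B (fun b => (N b).subtype (· ∈ R)) s d n hs
    (by simpa using hR) hB
  refine ⟨R'.map (Function.Embedding.subtype _), ?_, by simpa using h1, ?_⟩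
  · intro r hr
    obtain ⟨x, -, rfl⟩ := mem_map.1 hr
    exact x.2
  · refine le_trans (le_of_eq ?_) h2
    rw [sum_filter, sum_filter]
    refine sum_congr rfl fun b hb => ?_
    have : #{r ∈ (N b).subtype (· ∈ R) | r ∈ R'} =
        #{r ∈ N b | r ∈ R'.map (Function.Embedding.subtype _)} := by
      rw [← card_map (Function.Embedding.subtype _)]
      congr 1
      ext r
      simp only [mem_map, mem_filter, mem_subtype, Function.Embedding.subtype_apply]
      constructor
      · rintro ⟨x, ⟨h, h'⟩, rfl⟩
        exact ⟨h, x, h', rfl⟩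
      · rintro ⟨h, x, h', rfl⟩
        exact ⟨x, ⟨h, h'⟩, rfl⟩
    rw [this, hcard b hb]

namespace NullLine

open MvPolynomial

variable {K : Type*} [Field K]

/-- Incidence bound for two families of null lines in characteristic `p`. -/
theorem Config.inc_le [Infinite K] (p : ℕ) [CharP K p] (s : ℕ) (hs : 5400 ≤ s) (k n : ℕ)
    (hn : 54 * n < s * p ^ 2) {R B : Finset (NullLine K)} (h : Config R B k) (hR : R.card ≤ n)
    (hB : B.card ≤ n) : inc R B ≤ 20 * (s + 1) * (n * (n.sqrt + k)) := by
  classical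
  induction n using Nat.strong_induction_on generalizing R B with
  | _ n ih =>
    rcases Nat.eq_zero_or_pos n with rfl | hpos
    · have : R = ∅ := Finset.card_eq_zero.1 (by omega)
      subst this
      simp [inc]
    obtain ⟨M, hM⟩ : ∃ M, M = 2 * n / s := ⟨_, rfl⟩
    have hsM : s * M ≤ 2 * n := hM ▸ Nat.mul_div_le _ _
    obtain ⟨e, he⟩ : ∃ e, e = (3 * M).sqrt := ⟨_, rfl⟩
    have he1 : e * e ≤ 3 * M := he ▸ Nat.sqrt_le _
    have he2 : 3 * M < (e + 1) * (e + 1) := he ▸ Nat.lt_succ_sqrt _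
    obtain ⟨d, hd⟩ : ∃ d, d = 3 * e := ⟨_, rfl⟩
    have hsd : s * d ^ 2 ≤ 54 * n := by
      have : s * (e * e) ≤ s * (3 * M) := by gcongr
      rw [hd]
      nlinarith
    have hdp : d < p := by
      have : s * d ^ 2 < s * p ^ 2 := hsd.trans_lt hn
      exact lt_of_pow_lt_pow_left₀ 2 (Nat.zero_le _) (lt_of_mul_lt_mul_left this (Nat.zero_le _))
    have hdn : 100 * d ^ 2 ≤ n := by
      have : 5400 * d ^ 2 ≤ s * d ^ 2 := by gcongr
      omega
    have hdsqrt : d ≤ n.sqrt := Nat.le_sqrt'.2 (by omega)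
    have hsqrt : 1 ≤ n.sqrt := Nat.sqrt_pos.2 hpos
    obtain ⟨R', hR', hR'c, hlost⟩ := exists_sample R B (fun b => neighbors R b)
      (fun b _ => neighbors_subset _ _) s d n (by omega) hR hB
    have hR'M : R'.card ≤ M := by
      rw [hM, Nat.le_div_iff_mul_le (by omega), mul_comm]
      exact hR'c
    obtain ⟨P, hP, hPd, hPR⟩ := exists_on_of_card_lt R' e (by
      have : (3 * e + 1) * R'.card ≤ (3 * e + 1) * M := by gcongr
      nlinarith)
    rw [← hd] at hPd
    have hsplit := inc_filter_right R B (fun b => b.On P)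
    have hoff : inc R (B.filter fun b => ¬ b.On P) ≤ 2 * s * d * n + 8 * s * n := by
      rw [inc_comm, inc, ← Finset.sum_filter_add_sum_filter_not _
        (fun b => 2 * s * d ≤ (neighbors R b).card), add_comm]
      refine Nat.add_le_add ?_ ((Finset.sum_le_sum_of_subset ?_).trans hlost)
      · refine (Finset.sum_le_card_nsmul _ _ (2 * s * d) ?_).trans ?_
        · intro b hb
          exact (not_le.1 (Finset.mem_filter.1 hb).2).le
        · rw [smul_eq_mul, mul_comm]
          gcongr
          exact ((Finset.card_filter_le _ _).trans (Finset.card_filter_le _ _)).trans hB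
      · intro b hb
        simp only [Finset.mem_filter] at hb ⊢
        refine ⟨hb.1.1, ?_, hb.2⟩
        have h1 := card_neighbors_le_of_not_on hb.1.2 R'
          (fun r hr r' hr' => h.not_meets_left r (hR' hr) r' (hR' hr')) hPR
        refine le_trans (Finset.card_le_card ?_) (h1.trans hPd)
        intro r hr
        obtain ⟨hr, hr'⟩ := Finset.mem_filter.1 hr
        exact mem_neighbors.2 ⟨hr', (mem_neighbors.1 hr).2⟩
    obtain ⟨R₁, hR₁, B₁, hB₁, hR₁c, hB₁c, hon⟩ := (h.mono subset_rfl
      (Finset.filter_subset (fun b => b.On P) B)).exists_exceptional p P hP (hPd.trans_lt hdp) _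
      (fun b hb => (Finset.mem_filter.1 hb).2)
    have hPd2 : P.totalDegree ^ 2 ≤ d ^ 2 := by gcongr
    have hrec := ih (25 * d ^ 2) (by omega) (by omega)
      (h.mono hR₁ (hB₁.trans (Finset.filter_subset _ _))) (by omega) (by omega)
    have hrec' : 4 * (25 * d ^ 2 * ((25 * d ^ 2).sqrt + k)) ≤ n * (n.sqrt + k) := by
      have h1 : (25 * d ^ 2).sqrt ≤ n.sqrt := Nat.sqrt_le_sqrt (by omega)
      calc _ = 100 * d ^ 2 * ((25 * d ^ 2).sqrt + k) := by ring
        _ ≤ _ := by gcongr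
    have hBf : (B.filter fun b => b.On P).card ≤ n := (Finset.card_filter_le _ _).trans hB
    have e1 : 5 * P.totalDegree * R.card ≤ 5 * (n * n.sqrt) := by
      calc _ ≤ 5 * n.sqrt * n := by gcongr; exact hPd.trans hdsqrt
        _ = _ := by ring
    have e2 : 4 * P.totalDegree * (B.filter fun b => b.On P).card ≤ 4 * (n * n.sqrt) := by
      calc _ ≤ 4 * n.sqrt * n := by gcongr; exact hPd.trans hdsqrt
        _ = _ := by ring
    have e3 : k * (B.filter fun b => b.On P).card ≤ n * k := by
      rw [mul_comm]
      gcongr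
    have e4 : 2 * s * d * n + 8 * s * n ≤ 10 * s * (n * n.sqrt) := by
      have h1 : 2 * s * d * n ≤ 2 * s * n.sqrt * n := by gcongr
      have h2 : 8 * s * n * 1 ≤ 8 * s * n * n.sqrt := by gcongr
      calc _ ≤ 2 * s * n.sqrt * n + 8 * s * n * n.sqrt := by omega
        _ = _ := by ring
    have e5 : 20 * (s + 1) * (25 * d ^ 2 * ((25 * d ^ 2).sqrt + k)) ≤
        5 * (s + 1) * (n * (n.sqrt + k)) := by
      calc _ = 5 * (s + 1) * (4 * (25 * d ^ 2 * ((25 * d ^ 2).sqrt + k))) := by ring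
        _ ≤ _ := by gcongr
    have e6 : 0 ≤ s * (n * k) := Nat.zero_le _
    have e7 : 0 ≤ s * (n * n.sqrt) := Nat.zero_le _
    rw [hsplit]
    calc _ ≤ 5 * (n * n.sqrt) + 4 * (n * n.sqrt) + n * k + 5 * (s + 1) * (n * (n.sqrt + k)) +
          10 * s * (n * n.sqrt) := by omega
      _ ≤ _ := by nlinarith

end NullLine

namespace NullLine

variable {F K : Type*} [Field F] [Field K] [Algebra F K]

/-- The null line attached to `y`, `a'`, `b`. -/
noncomputable def redLine (κ : K) (t : F × F × F) : NullLine K :=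
  ⟨κ * algebraMap F K t.1, algebraMap F K t.2.1,
    -algebraMap F K t.1 * (algebraMap F K t.2.2 + κ ^ 2) +
      κ * algebraMap F K t.1 * algebraMap F K t.2.1⟩

/-- The null line attached to `y'`, `b'`, `a`. -/
noncomputable def blueLine (κ : K) (t : F × F × F) : NullLine K :=
  ⟨algebraMap F K t.1, κ⁻¹ * (algebraMap F K t.2.2 + κ ^ 2),
    -algebraMap F K t.1 * algebraMap F K t.2.1 +
      algebraMap F K t.1 * (κ⁻¹ * (algebraMap F K t.2.2 + κ ^ 2))⟩

/-- The elements `1`, `κ`, `κ²` are linearly independent over `F`. -/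
def Generic (F : Type*) {K : Type*} [Field F] [Field K] [Algebra F K] (κ : K) : Prop :=
  ∀ a b c : F, algebraMap F K a + algebraMap F K b * κ + algebraMap F K c * κ ^ 2 = 0 →
    a = 0 ∧ b = 0 ∧ c = 0

theorem Generic.ne_zero {κ : K} (hκ : Generic F κ) : κ ≠ 0 := by
  rintro rfl
  have := hκ 0 1 0 (by simp)
  simp at this

theorem generic_X : Generic F (RatFunc.X : RatFunc F) := by
  intro a b c h
  have h1 : algebraMap (Polynomial F) (RatFunc F)
      (Polynomial.C a + Polynomial.C b * Polynomial.X + Polynomial.C c * Polynomial.X ^ 2) = 0 := by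
    rw [← h]
    simp [RatFunc.algebraMap_eq_C]
  rw [map_eq_zero_iff _ (IsFractionRing.injective (Polynomial F) (RatFunc F))] at h1
  refine ⟨?_, ?_, ?_⟩
  · simpa using congrArg (Polynomial.coeff · 0) h1
  · simpa [Polynomial.coeff_X, Polynomial.coeff_C] using congrArg (Polynomial.coeff · 1) h1
  · simpa [Polynomial.coeff_X, Polynomial.coeff_C] using congrArg (Polynomial.coeff · 2) h1

variable {κ : K}

theorem Generic.redLine_m_ne (hκ : Generic F κ) {t t' : F × F × F} (ht : t.1 ≠ 0) :
    (redLine κ t).m ≠ (blueLine κ t').m := by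
  intro h
  have h' : κ * algebraMap F K t.1 = algebraMap F K t'.1 := h
  refine ht (hκ (-t'.1) t.1 0 ?_).2.1
  simp only [map_neg, map_zero]
  linear_combination h'

theorem Generic.meets_iff (hκ : Generic F κ) {t t' : F × F × F} (ht : t.1 ≠ 0) :
    (redLine κ t).Meets (blueLine κ t') ↔
      t.1 * (t'.2.2 - t.2.2) = t'.1 * (t.2.1 - t'.2.1) := by
  have h0 := hκ.ne_zero
  rw [Meets, and_iff_right (hκ.redLine_m_ne ht), ← (algebraMap F K).injective.eq_iff]
  simp only [redLine, blueLine, map_mul, map_sub]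
  have : κ * κ⁻¹ = 1 := mul_inv_cancel₀ h0
  constructor
  · intro h
    linear_combination h - algebraMap F K t.1 * (algebraMap F K t'.2.2 + κ ^ 2) * this
  · intro h
    linear_combination h + algebraMap F K t.1 * (algebraMap F K t'.2.2 + κ ^ 2) * this

theorem Generic.not_meets_redLine (hκ : Generic F κ) (t t' : F × F × F) :
    ¬ (redLine κ t).Meets (redLine κ t') := by
  rintro ⟨h1, h2⟩
  simp only [redLine] at h1 h2
  have h3 := (hκ (-t.1 * t.2.2 + t'.1 * t'.2.2) (t.1 * t'.2.1 - t'.1 * t.2.1) (t'.1 - t.1) (by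
    simp only [map_mul, map_add, map_sub, map_neg]
    linear_combination h2)).2.2
  exact h1 (by rw [sub_eq_zero.1 h3])

theorem Generic.not_meets_blueLine (hκ : Generic F κ) (t t' : F × F × F) :
    ¬ (blueLine κ t).Meets (blueLine κ t') := by
  rintro ⟨h1, h2⟩
  have h0 := hκ.ne_zero
  simp only [blueLine] at h1 h2
  have h3 := (hκ (t.1 * t'.2.2 - t'.1 * t.2.2) (-t.1 * t.2.1 + t'.1 * t'.2.1) (t.1 - t'.1) (by
    simp only [map_mul, map_add, map_sub, map_neg]
    have : κ * κ⁻¹ = 1 := mul_inv_cancel₀ h0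
    linear_combination κ * h2 - (algebraMap F K t.1 * (algebraMap F K t'.2.2 + κ ^ 2) -
      algebraMap F K t'.1 * (algebraMap F K t.2.2 + κ ^ 2)) * this)).2.2
  exact h1 (by rw [sub_eq_zero.1 h3])

theorem Generic.redLine_injOn (hκ : Generic F κ) :
    Set.InjOn (redLine κ) {t : F × F × F | t.1 ≠ 0} := by
  rintro ⟨y, a, b⟩ hy ⟨y', a', b'⟩ - h
  have h0 := hκ.ne_zero
  have hinj := (algebraMap F K).injective
  simp only [redLine, NullLine.mk.injEq] at h
  obtain ⟨h1, h2, h3⟩ := h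
  obtain rfl := hinj (mul_left_cancel₀ h0 h1)
  obtain rfl := hinj h2
  have h4 : algebraMap F K y * algebraMap F K b = algebraMap F K y * algebraMap F K b' := by
    linear_combination -h3
  obtain rfl := hinj (mul_left_cancel₀ ((map_ne_zero _).2 hy) h4)
  rfl

theorem Generic.blueLine_injOn (hκ : Generic F κ) :
    Set.InjOn (blueLine κ) {t : F × F × F | t.1 ≠ 0} := by
  rintro ⟨y, a, b⟩ hy ⟨y', a', b'⟩ - h
  have h0 := hκ.ne_zero
  have hinj := (algebraMap F K).injective
  simp only [blueLine, NullLine.mk.injEq] at h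
  obtain ⟨h1, h2, h3⟩ := h
  obtain rfl := hinj h1
  have h5 := mul_left_cancel₀ (inv_ne_zero h0) h2
  obtain rfl := hinj (add_right_cancel h5)
  have h4 : algebraMap F K y * algebraMap F K a = algebraMap F K y * algebraMap F K a' := by
    linear_combination -h3
  obtain rfl := hinj (mul_left_cancel₀ ((map_ne_zero _).2 hy) h4)
  rfl

open Classical in
theorem Generic.isConfig (hκ : Generic F κ) (Y C : Finset F) (hY : (0 : F) ∉ Y) :
    Config ((Y ×ˢ C ×ˢ C).image (redLine κ)) ((Y ×ˢ C ×ˢ C).image (blueLine κ))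
      (Y.card + C.card) := by
  have hne : ∀ t ∈ Y ×ˢ C ×ˢ C, t.1 ≠ 0 := by
    intro t ht h
    exact hY (h ▸ (Finset.mem_product.1 ht).1)
  constructor
  · intro r hr b hb
    obtain ⟨t, ht, rfl⟩ := Finset.mem_image.1 hr
    obtain ⟨t', ht', rfl⟩ := Finset.mem_image.1 hb
    exact hκ.redLine_m_ne (hne t ht)
  · intro r hr b hb
    obtain ⟨t, ht, rfl⟩ := Finset.mem_image.1 hr
    obtain ⟨t', ht', rfl⟩ := Finset.mem_image.1 hb
    exact hκ.not_meets_redLine t t'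
  · intro r hr b hb
    obtain ⟨t, ht, rfl⟩ := Finset.mem_image.1 hr
    obtain ⟨t', ht', rfl⟩ := Finset.mem_image.1 hb
    exact hκ.not_meets_blueLine t t'
  · intro b₁ hb₁ b₂ hb₂ hb S hS hSm
    obtain ⟨t₁, ht₁, rfl⟩ := Finset.mem_image.1 hb₁
    obtain ⟨t₂, ht₂, rfl⟩ := Finset.mem_image.1 hb₂
    have hS' : ∀ r ∈ S, ∃ t ∈ Y ×ˢ C ×ˢ C, redLine κ t = r ∧
        t.1 * (t₁.2.2 - t.2.2) = t₁.1 * (t.2.1 - t₁.2.1) ∧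
        t.1 * (t₂.2.2 - t.2.2) = t₂.1 * (t.2.1 - t₂.2.1) := by
      intro r hr
      obtain ⟨t, ht, rfl⟩ := Finset.mem_image.1 (hS hr)
      obtain ⟨h1, h2⟩ := hSm _ hr
      exact ⟨t, ht, rfl, (hκ.meets_iff (hne t ht)).1 h1, (hκ.meets_iff (hne t ht)).1 h2⟩
    have hne₁ := hne t₁ ht₁
    obtain ⟨y₁, b₁, a₁⟩ := t₁
    obtain ⟨y₂, b₂, a₂⟩ := t₂
    simp only at hS' hne₁
    choose! g hg hgr h1 h2 using hS'
    have hginj : Set.InjOn g S := fun r hr r' hr' h => by rw [← hgr r hr, ← hgr r' hr', h]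
    by_cases hy : y₁ = y₂
    · subst hy
      refine le_trans (Finset.card_le_card_of_injOn (fun r => (g r).2.1) ?_ ?_)
        (Nat.le_add_left _ _)
      · intro r hr
        exact (Finset.mem_product.1 (Finset.mem_product.1 (hg r hr)).2).1
      · intro r hr r' hr' (h : (g r).2.1 = (g r').2.1)
        apply hginj hr hr'
        have e1 := h1 r hr
        have e2 := h2 r hr
        have e1' := h1 r' hr'
        have e2' := h2 r' hr'
        have ha : a₁ ≠ a₂ := by
          rintro rfl
          have h3 : y₁ * b₁ = y₁ * b₂ := by linear_combination e1 - e2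
          obtain rfl := mul_left_cancel₀ hne₁ h3
          exact hb rfl
        have h4 : (g r).1 * (a₁ - a₂) = (g r').1 * (a₁ - a₂) := by
          linear_combination e1 - e2 - e1' + e2'
        have h5 := mul_right_cancel₀ (sub_ne_zero.2 ha) h4
        have h6 : (g r).1 * (g r).2.2 = (g r).1 * (g r').2.2 := by
          rw [← h5] at e1'
          rw [← h] at e1'
          linear_combination e1' - e1
        have h7 := mul_left_cancel₀ (hne _ (hg r hr)) h6
        exact Prod.ext h5 (Prod.ext h h7)
    · refine le_trans (Finset.card_le_card_of_injOn (fun r => (g r).1) ?_ ?_)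
        (Nat.le_add_right _ _)
      · intro r hr
        exact (Finset.mem_product.1 (hg r hr)).1
      · intro r hr r' hr' (h : (g r).1 = (g r').1)
        apply hginj hr hr'
        have e1 := h1 r hr
        have e2 := h2 r hr
        have e1' := h1 r' hr'
        have e2' := h2 r' hr'
        rw [← h] at e1' e2'
        have h4 : (y₁ - y₂) * (g r).2.1 = (y₁ - y₂) * (g r').2.1 := by
          linear_combination e2 - e1 - e2' + e1'
        have h5 := mul_left_cancel₀ (sub_ne_zero.2 hy) h4
        have h6 : (g r).1 * (g r).2.2 = (g r).1 * (g r').2.2 := by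
          rw [← h5] at e1'
          linear_combination e1' - e1
        have h7 := mul_left_cancel₀ (hne _ (hg r hr)) h6
        exact Prod.ext h (Prod.ext h5 h7)

open Classical in
theorem Generic.card_le_inc [DecidableEq F] (hκ : Generic F κ) (Y C : Finset F) (hY : (0 : F) ∉ Y) :
    (((Y ×ˢ C ×ˢ C) ×ˢ (Y ×ˢ C ×ˢ C)).filter fun t =>
      t.1.1 * (t.1.2.1 - t.1.2.2) = t.2.1 * (t.2.2.1 - t.2.2.2)).card ≤
    inc ((Y ×ˢ C ×ˢ C).image (redLine κ)) ((Y ×ˢ C ×ˢ C).image (blueLine κ)) := by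
  have hne : ∀ y ∈ Y, y ≠ 0 := fun y hy h => hY (h ▸ hy)
  rw [inc_eq_card]
  refine Finset.card_le_card_of_injOn (fun t =>
    (redLine κ (t.1.1, t.2.2.1, t.1.2.2), blueLine κ (t.2.1, t.2.2.2, t.1.2.1))) ?_ ?_
  · rintro ⟨⟨y, a, b⟩, ⟨y', a', b'⟩⟩ ht
    simp only [Finset.coe_filter, Finset.mem_product, Set.mem_ofPred_eq] at ht
    obtain ⟨⟨⟨h1, h2, h3⟩, h4, h5, h6⟩, h⟩ := ht
    simp only [Finset.coe_filter, Finset.mem_product, Set.mem_ofPred_eq]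
    refine ⟨⟨Finset.mem_image_of_mem _ ?_, Finset.mem_image_of_mem _ ?_⟩, ?_⟩
    · simp [h1, h5, h3]
    · simp [h4, h6, h2]
    · exact (hκ.meets_iff (hne y h1)).2 h
  · rintro ⟨⟨y, a, b⟩, ⟨y', a', b'⟩⟩ ht ⟨⟨z, c, d⟩, ⟨z', c', d'⟩⟩ ht' h
    simp only [Finset.coe_filter, Finset.mem_product, Set.mem_ofPred_eq] at ht ht'
    simp only [Prod.mk.injEq] at h
    have h1 := hκ.redLine_injOn (hne y ht.1.1.1) (hne z ht'.1.1.1) h.1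
    have h2 := hκ.blueLine_injOn (hne y' ht.1.2.1) (hne z' ht'.1.2.1) h.2
    simp only [Prod.mk.injEq] at h1 h2 ⊢
    tauto

end NullLine

/-- Incidence bound for the equation `y (a - b) = y' (a' - b')`. -/
theorem card_mul_sub_eq_mul_sub_le {p : ℕ} [Fact p.Prime] (s : ℕ) (hs : 5400 ≤ s)
    (Y C : Finset (ZMod p)) (hY : (0 : ZMod p) ∉ Y)
    (hn : 54 * (Y.card * C.card ^ 2) < s * p ^ 2) :
    (((Y ×ˢ C ×ˢ C) ×ˢ (Y ×ˢ C ×ˢ C)).filter fun t =>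
      t.1.1 * (t.1.2.1 - t.1.2.2) = t.2.1 * (t.2.2.1 - t.2.2.2)).card ≤
    20 * (s + 1) * (Y.card * C.card ^ 2 *
      ((Y.card * C.card ^ 2).sqrt + (Y.card + C.card))) := by
  have : CharP (RatFunc (ZMod p)) p := charP_of_injective_algebraMap
    (algebraMap (ZMod p) (RatFunc (ZMod p))).injective p
  have hgen : NullLine.Generic (ZMod p) (RatFunc.X : RatFunc (ZMod p)) := NullLine.generic_X
  have : Infinite (RatFunc (ZMod p)) :=
    Infinite.of_injective _ (IsFractionRing.injective (Polynomial (ZMod p)) (RatFunc (ZMod p)))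
  have hcard : (Y ×ˢ C ×ˢ C).card = Y.card * C.card ^ 2 := by
    simp [Finset.card_product, sq]
  classical
  exact (hgen.card_le_inc Y C hY).trans ((hgen.isConfig Y C hY).inc_le p s hs _ _ hn
    (Finset.card_image_le.trans hcard.le) (Finset.card_image_le.trans hcard.le))

open Finset in
theorem sum_card_fiber_mul {α β γ : Type*} [DecidableEq γ] [Fintype γ] (A : Finset α)
    (B : Finset β) (φ : α → γ) (ψ : β → γ) :
    ∑ z, #{x ∈ A | φ x = z} * #{x ∈ B | ψ x = z} =
      #{t ∈ A ×ˢ B | φ t.1 = ψ t.2} := by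
  classical
  rw [card_eq_sum_card_fiberwise (f := fun t : α × β => φ t.1) (t := univ) (by simp)]
  refine sum_congr rfl fun z _ => ?_
  rw [← card_product]
  congr 1
  ext ⟨x, x'⟩
  simp only [mem_product, mem_filter]
  constructor
  · rintro ⟨⟨h1, h2⟩, h3, h4⟩
    exact ⟨⟨⟨h1, h3⟩, h2.trans h4.symm⟩, h2⟩
  · rintro ⟨⟨⟨h1, h3⟩, h⟩, h2⟩
    exact ⟨⟨h1, h2⟩, h3, h.symm.trans h2⟩

open Finset in
theorem card_sq_le_card_image_mul {α γ : Type*} [DecidableEq γ] [Fintype γ] (A : Finset α)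
    (φ : α → γ) : #A ^ 2 ≤ #(A.image φ) * #{t ∈ A ×ˢ A | φ t.1 = φ t.2} := by
  rw [← sum_card_fiber_mul, card_eq_sum_card_image φ A]
  refine sq_sum_le_card_mul_sum_sq.trans (Nat.mul_le_mul_left _ ?_)
  simp only [sq]
  exact sum_le_sum_of_subset (subset_univ _)

open Finset in
/-- Cauchy–Schwarz bound for the average energy of `C` and its dilates. -/
theorem sq_sum_dilate_energy_le {F : Type*} [Field F] [Fintype F] [DecidableEq F]
    (Y C : Finset F) :
    (∑ y ∈ Y, #{t ∈ (C ×ˢ C) ×ˢ (C ×ˢ C) | t.1.1 * y + t.1.2 = t.2.1 * y + t.2.2}) ^ 2 ≤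
      #{t ∈ (C ×ˢ C) ×ˢ (C ×ˢ C) | t.1.1 - t.1.2 = t.2.1 - t.2.2} *
      #{t ∈ (Y ×ˢ C ×ˢ C) ×ˢ (Y ×ˢ C ×ˢ C) |
        t.1.1 * (t.1.2.1 - t.1.2.2) = t.2.1 * (t.2.2.1 - t.2.2.2)} := by
  have h1 : ∀ y, #{t ∈ (C ×ˢ C) ×ˢ (C ×ˢ C) | t.1.1 * y + t.1.2 = t.2.1 * y + t.2.2} =
      #{t ∈ (C ×ˢ C) ×ˢ (C ×ˢ C) | t.1.1 - t.1.2 = y * (t.2.1 - t.2.2)} := by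
    intro y
    refine card_bij' (fun t _ => ((t.1.2, t.2.2), (t.2.1, t.1.1)))
      (fun t _ => ((t.2.2, t.1.1), (t.2.1, t.1.2))) ?_ ?_ ?_ ?_
    · rintro ⟨⟨a, b⟩, ⟨c, d⟩⟩ h
      simp only [mem_filter, mem_product] at h ⊢
      exact ⟨by tauto, by linear_combination h.2⟩
    · rintro ⟨⟨a, b⟩, ⟨c, d⟩⟩ h
      simp only [mem_filter, mem_product] at h ⊢
      exact ⟨by tauto, by linear_combination h.2⟩
    · intros; rfl
    · intros; rfl
  have h2 : ∀ z, ∑ y ∈ Y, #{x ∈ C ×ˢ C | y * (x.1 - x.2) = z} =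
      #{t ∈ Y ×ˢ C ×ˢ C | t.1 * (t.2.1 - t.2.2) = z} := by
    intro z
    simp only [card_filter, sum_product]
  have h3 : ∑ y ∈ Y, #{t ∈ (C ×ˢ C) ×ˢ (C ×ˢ C) | t.1.1 * y + t.1.2 = t.2.1 * y + t.2.2} =
      ∑ z, #{x ∈ C ×ˢ C | x.1 - x.2 = z} * #{t ∈ Y ×ˢ C ×ˢ C | t.1 * (t.2.1 - t.2.2) = z} := by
    simp only [h1, ← h2, mul_sum]
    rw [sum_comm]
    refine sum_congr rfl fun y _ => ?_
    rw [← sum_card_fiber_mul (C ×ˢ C) (C ×ˢ C) (fun x => x.1 - x.2) fun x => y * (x.1 - x.2)]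
  rw [h3, ← sum_card_fiber_mul (C ×ˢ C) (C ×ˢ C) (fun x => x.1 - x.2) fun x => x.1 - x.2,
    ← sum_card_fiber_mul (Y ×ˢ C ×ˢ C) (Y ×ˢ C ×ˢ C) (fun t => t.1 * (t.2.1 - t.2.2))
      fun t => t.1 * (t.2.1 - t.2.2)]
  simpa only [sq] using sum_mul_sq_le_sq_mul_sq univ
    (fun z => #{x ∈ C ×ˢ C | x.1 - x.2 = z}) fun z => #{t ∈ Y ×ˢ C ×ˢ C | t.1 * (t.2.1 - t.2.2) = z}

open Finset in
theorem addEnergy_coe {F : Type*} [Field F] [DecidableEq F] (C : Finset F) :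
    addEnergy (C : Set F) = #{t ∈ (C ×ˢ C) ×ˢ (C ×ˢ C) | t.1.1 - t.1.2 = t.2.1 - t.2.2} := by
  rw [_root_.addEnergy, addEnergy2, ← Set.ncard_coe_finset]
  refine Set.ncard_congr (fun t _ => ((t.1, t.2.2.2), (t.2.2.1, t.2.1))) ?_ ?_ ?_
  · rintro ⟨a, b, c, d⟩ h
    simp only [Set.mem_ofPred_eq, mem_coe, coe_filter, mem_product] at h ⊢
    exact ⟨by tauto, by linear_combination h.2.2.2.2⟩
  · rintro ⟨a, b, c, d⟩ ⟨a', b', c', d'⟩ _ _ h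
    simp only [Prod.mk.injEq] at h ⊢
    tauto
  · rintro ⟨⟨a, b⟩, ⟨c, d⟩⟩ h
    simp only [Set.mem_ofPred_eq, coe_filter, mem_product] at h
    refine ⟨(a, d, c, b), ?_, rfl⟩
    simp only [Set.mem_ofPred_eq, mem_coe]
    exact ⟨h.1.1.1, h.1.2.2, h.1.2.1, h.1.1.2, by linear_combination h.2⟩

open Finset in
/-- The image of `C × C` in some direction of `Y` is large. -/
theorem exists_image_card_ge {p : ℕ} [Fact p.Prime] (s : ℕ) (hs : 5400 ≤ s)
    (Y C : Finset (ZMod p)) (hYne : Y.Nonempty) (hY : (0 : ZMod p) ∉ Y)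
    (hn : 54 * (#Y * #C ^ 2) < s * p ^ 2) :
    ∃ y ∈ Y, (#Y * #C ^ 4) ^ 2 ≤ #((C ×ˢ C).image fun z => z.1 * y + z.2) ^ 2 *
      (addEnergy (C : Set (ZMod p)) *
        (20 * (s + 1) * (#Y * #C ^ 2 * ((#Y * #C ^ 2).sqrt + (#Y + #C))))) := by
  classical
  have h1 := card_mul_sub_eq_mul_sub_le s hs Y C hY hn
  have h2 := sq_sum_dilate_energy_le Y C
  rw [← addEnergy_coe] at h2
  obtain ⟨y, hy, hmin⟩ := exists_min_image Y
    (fun y => #{t ∈ (C ×ˢ C) ×ˢ (C ×ˢ C) | t.1.1 * y + t.1.2 = t.2.1 * y + t.2.2}) hYne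
  refine ⟨y, hy, ?_⟩
  have h3 := card_nsmul_le_sum Y _ _ hmin
  have h4 := card_sq_le_card_image_mul (C ×ˢ C) fun z => z.1 * y + z.2
  rw [card_product] at h4
  rw [smul_eq_mul] at h3
  set I := #((C ×ˢ C).image fun z => z.1 * y + z.2)
  calc (#Y * #C ^ 4) ^ 2 = (#Y * (#C * #C) ^ 2) ^ 2 := by ring
    _ ≤ (#Y * (I * #{t ∈ (C ×ˢ C) ×ˢ (C ×ˢ C) | t.1.1 * y + t.1.2 = t.2.1 * y + t.2.2})) ^ 2 := by
      gcongr
    _ = I ^ 2 * (#Y * #{t ∈ (C ×ˢ C) ×ˢ (C ×ˢ C) |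
        t.1.1 * y + t.1.2 = t.2.1 * y + t.2.2}) ^ 2 := by ring
    _ ≤ _ := by
      gcongr
      exact (Nat.pow_le_pow_left h3 2).trans (h2.trans (Nat.mul_le_mul_left _ h1))

theorem rpow_div_le_of_sq_le {A₀ c₁ y c e i q : ℝ} (hA₀ : 0 < A₀) (hc₁ : 0 ≤ c₁) (hy : 1 ≤ y)
    (hc : 1 ≤ c) (he : 0 < e) (hi : 0 ≤ i) (hyc : y ≤ c₁ * c ^ 2) (hq : q ≤ √y * c)
    (h : (y * c ^ 4) ^ 2 ≤ i ^ 2 * (e * (A₀ * (y * c ^ 2 * (q + (y + c)))))) :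
    y ^ (1/4 : ℝ) * c ^ (5/2 : ℝ) / e ^ (1/2 : ℝ) ≤ √(A₀ * (2 + √c₁)) * i := by
  have hys : √y ≤ √c₁ * c := by
    calc _ ≤ √(c₁ * c ^ 2) := Real.sqrt_le_sqrt hyc
      _ = _ := by rw [Real.sqrt_mul hc₁, Real.sqrt_sq (by positivity)]
  have hyy : y = √y * √y := (Real.mul_self_sqrt (by positivity)).symm
  have hsum : q + (y + c) ≤ (2 + √c₁) * (√y * c) := by
    have e1 : y ≤ √c₁ * (√y * c) := by
      calc y = √y * √y := hyy
        _ ≤ √y * (√c₁ * c) := by gcongr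
        _ = _ := by ring
    have e2 : c ≤ √y * c := le_mul_of_one_le_left (by positivity) (Real.one_le_sqrt.2 hy)
    linarith
  have hmain : (y * c ^ 4) ^ 2 ≤ i ^ 2 * (e * (A₀ * (2 + √c₁) * (√y * y * c ^ 3))) := by
    refine h.trans ?_
    calc _ ≤ i ^ 2 * (e * (A₀ * (y * c ^ 2 * ((2 + √c₁) * (√y * c))))) := by gcongr
      _ = _ := by ring
  have hT : √y * c ^ 5 / e ≤ A₀ * (2 + √c₁) * i ^ 2 := by
    rw [div_le_iff₀ he]
    have hpos : 0 < √y * y * c ^ 3 := by positivity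
    refine le_of_mul_le_mul_right ?_ hpos
    calc _ = (√y * √y) * y * c ^ 8 := by ring
      _ = (y * c ^ 4) ^ 2 := by rw [← hyy]; ring
      _ ≤ _ := hmain
      _ = _ := by ring
  have hsq : (y ^ (1/4 : ℝ) * c ^ (5/2 : ℝ) / e ^ (1/2 : ℝ)) ^ 2 = √y * c ^ 5 / e := by
    rw [div_pow, mul_pow, ← Real.rpow_natCast, ← Real.rpow_mul (by positivity),
      ← Real.rpow_natCast (c ^ (5/2 : ℝ)), ← Real.rpow_mul (by positivity),
      ← Real.rpow_natCast (e ^ (1/2 : ℝ)), ← Real.rpow_mul (by positivity),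
      Real.sqrt_eq_rpow, ← Real.rpow_natCast c 5]
    norm_num
  refine (abs_le_of_sq_le_sq' ?_ (by positivity)).2
  rw [hsq, mul_pow, Real.sq_sqrt (by positivity)]
  exact hT

/-- over a prime field, if $|Y| \le c_1 |C|^2$ and $|C|^2|Y| \le c_2 p^2$
with $Y \subseteq F_p^*$ nonempty, there is $y \in Y$ with
$\#\{ay+b : (a,b) \in C \times C\} \ge c \min(|Y|^{1/4}|C|^{5/2}/E^+(C)^{1/2}, |C|^2)$. -/
theorem statement16 :
    ∀ c₁ c₂ : ℝ, 0 < c₁ → 0 < c₂ →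
      ∃ c : ℝ, 0 < c ∧
        ∀ (p : ℕ) [Fact p.Prime] (Y C : Set (ZMod p)),
          Y.Nonempty → (0 : ZMod p) ∉ Y → C.Nonempty →
          (Y.ncard : ℝ) ≤ c₁ * (C.ncard : ℝ) ^ (2 : ℕ) →
          (C.ncard : ℝ) ^ (2 : ℕ) * (Y.ncard : ℝ) ≤ c₂ * (p : ℝ) ^ (2 : ℕ) →
          ∃ y ∈ Y,
            c * min ((Y.ncard : ℝ) ^ (1/4 : ℝ) * (C.ncard : ℝ) ^ (5/2 : ℝ) /
                    (addEnergy C : ℝ) ^ (1/2 : ℝ))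
                ((C.ncard : ℝ) ^ (2 : ℕ)) ≤
              (((fun z : ZMod p × ZMod p => z.1 * y + z.2) '' (C ×ˢ C)).ncard : ℝ) := by
  intro c₁ c₂ hc₁ hc₂
  obtain ⟨s, hs, hsc⟩ : ∃ s : ℕ, 5400 ≤ s ∧ 54 * c₂ < s := by
    obtain ⟨t, ht⟩ := exists_nat_gt (54 * c₂)
    exact ⟨max 5400 t, le_max_left _ _, ht.trans_le (by exact_mod_cast le_max_right _ _)⟩
  refine ⟨(√(20 * (s + 1) * (2 + √c₁)))⁻¹, by positivity, ?_⟩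
  intro p _ Y C hYne hY hCne h1 h2
  lift Y to Finset (ZMod p) using Y.toFinite
  lift C to Finset (ZMod p) using C.toFinite
  simp only [Set.ncard_coe_finset] at h1 h2 ⊢
  rw [Finset.coe_nonempty] at hYne hCne
  rw [Finset.mem_coe] at hY
  have hp : (0 : ℝ) < p := by exact_mod_cast (Fact.out : p.Prime).pos
  have hn : 54 * (Y.card * C.card ^ 2) < s * p ^ 2 := by
    have : (54 : ℝ) * (Y.card * C.card ^ 2) < s * p ^ 2 := by
      calc _ = 54 * ((C.card : ℝ) ^ 2 * Y.card) := by ring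
        _ ≤ 54 * (c₂ * p ^ 2) := by gcongr
        _ = 54 * c₂ * p ^ 2 := by ring
        _ < _ := by gcongr
    exact_mod_cast this
  obtain ⟨y, hy, h⟩ := exists_image_card_ge s hs Y C hYne hY hn
  refine ⟨y, hy, ?_⟩
  have himg : (fun z : ZMod p × ZMod p => z.1 * y + z.2) '' ((C : Set (ZMod p)) ×ˢ C) =
      ((C ×ˢ C).image fun z => z.1 * y + z.2 : Finset (ZMod p)) := by simp
  rw [himg, Set.ncard_coe_finset]
  set E := addEnergy (C : Set (ZMod p)) with hE
  have hY1 : (1 : ℝ) ≤ Y.card := by exact_mod_cast hYne.card_pos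
  have hC1 : (1 : ℝ) ≤ C.card := by exact_mod_cast hCne.card_pos
  have hEpos : (0 : ℝ) < E := by
    rw [hE, addEnergy_coe]
    obtain ⟨a, ha⟩ := hCne
    exact_mod_cast Finset.card_pos.2 ⟨((a, a), (a, a)), by simp [ha]⟩
  have hQ : ((Y.card * C.card ^ 2).sqrt : ℝ) ≤ √Y.card * C.card := by
    refine Real.nat_sqrt_le_real_sqrt.trans (le_of_eq ?_)
    push_cast
    rw [Real.sqrt_mul (by positivity), Real.sqrt_sq (by positivity)]
  rw [inv_mul_le_iff₀ (by positivity)]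
  exact (min_le_left _ _).trans (rpow_div_le_of_sq_le (by positivity) hc₁.le hY1 hC1 hEpos
    (Nat.cast_nonneg _) h1 hQ (by exact_mod_cast h))
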